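/- arXiv:2207.14523 — 2 statements merged into one kernel-verified Lean document; each statement's English description precedes it below -/
import Mathlib

section
/- Let K be an algebraically closed field and let f, g ∈ K[[x,y]] be elementary power series with Newton polygons N_f = {S} and N_g = {T}. Then i₀(f,g) ≥ [S,T], with equality if and only if S and T are not parallel or the system of equations In f = 0, In g = 0 has the unique solution (x,y) = (0,0). -/
/-!
Common definitions for formalizing "A note on the plane curve singularities in
positive characteristic" by E. García Barroso and A. Płoski.

We work with the ring `K[[x,y]] := MvPowerSeries (Fin 2) K`, where `x` is the
variable of index `0` and `y` the variable of index `1`.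
-/

open scoped Classical

noncomputable section

universe u

namespace PlaneCurveNote

/-- The formal power series ring `K[[x,y]]`. -/
abbrev PS (K : Type u) [Field K] := MvPowerSeries (Fin 2) K

variable (K : Type u) [Field K]

/-- The variable `x`. -/
def Xv : PS K := MvPowerSeries.X 0

/-- The variable `y`. -/
def Yv : PS K := MvPowerSeries.X 1

/-- The coefficient `c_{αβ}` of `x^α y^β` in `f`. -/
def coef (f : PS K) (p : ℕ × ℕ) : K :=
  MvPowerSeries.coeff (Finsupp.single 0 p.1 + Finsupp.single 1 p.2) f

/-- The support of a power series, as a subset of `ℕ²`. -/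
def supp (f : PS K) : Set (ℕ × ℕ) := {p | coef K f p ≠ 0}

/-- Build a power series from a coefficient function on `ℕ²`. -/
def ofCoef (c : ℕ × ℕ → K) : PS K := fun d => c (d 0, d 1)

/-- A reduced power series: nonzero, without constant term and without multiple factors. -/
def IsReducedSeries (f : PS K) : Prop :=
  f ≠ 0 ∧ MvPowerSeries.constantCoeff f = 0 ∧ Squarefree f

/-- `r(f)`: the number of irreducible factors of `f` (counted up to associates,
i.e. the number of distinct irreducible components of the curve `f = 0` when `f` is reduced). -/
def numFactors (f : PS K) : ℕ :=
  Set.ncard {P : Associates (PS K) | Irreducible P ∧ P ∣ Associates.mk f}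

/-- The local ring `O_f = K[[x,y]]/(f)` of the curve `f = 0`. -/
abbrev CurveRing (f : PS K) := PS K ⧸ Ideal.span ({f} : Set (PS K))

/-- `deltaSpec K f d` expresses that `d = δ(f) = dim_K Ō_f/O_f`, where `Ō_f` is the integral
closure of `O_f = K[[x,y]]/(f)` in (any model `L` of) its total ring of fractions. -/
def deltaSpec (f : PS K) (d : ℕ) : Prop :=
  ∀ (L : Type u) [CommRing L] [Algebra K L] [Algebra (CurveRing K f) L]
    [IsScalarTower K (CurveRing K f) L] [IsFractionRing (CurveRing K f) L],
    letI N : Submodule K L := Submodule.span K ((integralClosure (CurveRing K f) L : Set L))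
    letI P : Submodule K L := Submodule.span K (Set.range (algebraMap (CurveRing K f) L))
    d = Module.finrank K (↥N ⧸ (P.comap N.subtype))

/-- `δ(f)`, the delta invariant of `f`. -/
def delta (f : PS K) : ℕ := sInf {d | deltaSpec K f d}

/-- `μ̄(f) = 2δ(f) - r(f) + 1`, the invariant Milnor number of `f`. -/
def muBar (f : PS K) : ℤ := 2 * (delta K f : ℤ) - (numFactors K f : ℤ) + 1

/-- `i₀(f,g) = dim_K K[[x,y]]/(f,g)`, the intersection multiplicity of `f` and `g`
(as a natural number; meaningful when it is finite). -/
def iMult (f g : PS K) : ℕ :=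
  Module.finrank K (PS K ⧸ Ideal.span ({f, g} : Set (PS K)))

/-- `i₀(f,g)` as a cardinal (`dim_K K[[x,y]]/(f,g)`), allowing the infinite case. -/
def iMultC (f g : PS K) : Cardinal :=
  Module.rank K (PS K ⧸ Ideal.span ({f, g} : Set (PS K)))

/-- `Γ(f)`: the semigroup of values of an irreducible `f`, i.e. the set of intersection
multiplicities `i₀(f,g)` where `g` runs over power series with `g ≢ 0 (mod f)`. -/
def valueSemigroup (f : PS K) : Set ℕ :=
  {n | ∃ g : PS K, ¬ f ∣ g ∧ n = iMult K f g}

/-- `ord f`, the order of a power series. -/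
def ordSeries (f : PS K) : ℕ := sInf ((fun p => p.1 + p.2) '' supp K f)

/-- `m = ord f(x,0)`. -/
def ordX (f : PS K) : ℕ := sInf {a : ℕ | (a, 0) ∈ supp K f}

/-- `n = ord f(0,y)`. -/
def ordY (f : PS K) : ℕ := sInf {b : ℕ | (0, b) ∈ supp K f}

/-- `f` is convenient if `f(x,0) f(0,y) ≠ 0`. -/
def Convenient (f : PS K) : Prop :=
  (∃ a : ℕ, (a, 0) ∈ supp K f) ∧ (∃ b : ℕ, (0, b) ∈ supp K f)

/-- A Newton edge: a segment with vertices `(α,β)`, `(α',β') ∈ ℕ²`, `α < α'`, `β' < β`. -/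
structure NEdge : Type where
  A : ℕ × ℕ
  B : ℕ × ℕ
  hx : A.1 < B.1
  hy : B.2 < A.2

/-- `|S|₁ = α' - α`. -/
def NEdge.len1 (S : NEdge) : ℕ := S.B.1 - S.A.1

/-- `|S|₂ = β - β'`. -/
def NEdge.len2 (S : NEdge) : ℕ := S.A.2 - S.B.2

/-- `r(S) = gcd(|S|₁, |S|₂)`. -/
def NEdge.rE (S : NEdge) : ℕ := Nat.gcd S.len1 S.len2

/-- The lattice points lying on the segment `S`. -/
def NEdge.mem (S : NEdge) (p : ℕ × ℕ) : Prop :=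
  S.A.1 ≤ p.1 ∧ p.1 ≤ S.B.1 ∧ S.B.2 ≤ p.2 ∧ p.2 ≤ S.A.2 ∧
    (p.1 - S.A.1) * S.len2 = (S.A.2 - p.2) * S.len1

/-- `[S,T] = min{|S|₁|T|₂, |S|₂|T|₁}`. -/
def bracket (S T : NEdge) : ℕ := min (S.len1 * T.len2) (S.len2 * T.len1)

/-- The Newton polygon `N_f` of `f`, described as the set of compact edges of the boundary of
the Newton diagram of `f`: an edge belongs to `N_f` iff its endpoints lie in the support of `f`
and some weight vector `w` with positive entries attains its minimum on the support of `f`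
exactly on this segment. -/
def newtonPolygon (f : PS K) : Set NEdge :=
  {S | S.A ∈ supp K f ∧ S.B ∈ supp K f ∧
    ∃ w : ℕ × ℕ, 0 < w.1 ∧ 0 < w.2 ∧
      w.1 * S.B.1 + w.2 * S.B.2 = w.1 * S.A.1 + w.2 * S.A.2 ∧
      (∀ p ∈ supp K f, w.1 * S.A.1 + w.2 * S.A.2 ≤ w.1 * p.1 + w.2 * p.2) ∧
      (∀ p ∈ supp K f, w.1 * p.1 + w.2 * p.2 = w.1 * S.A.1 + w.2 * S.A.2 →
        S.A.1 ≤ p.1 ∧ p.1 ≤ S.B.1)}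

/-- `|N_f|₁ = Σ_{S ∈ N_f} |S|₁`. -/
def len1N (f : PS K) : ℕ := ∑ᶠ S ∈ newtonPolygon K f, S.len1

/-- `|N_f|₂ = Σ_{S ∈ N_f} |S|₂`. -/
def len2N (f : PS K) : ℕ := ∑ᶠ S ∈ newtonPolygon K f, S.len2

/-- `[N_f, N_f] = Σ_{S,T ∈ N_f} [S,T]`. -/
def bracketN (f : PS K) : ℕ := ∑ᶠ S ∈ newtonPolygon K f, ∑ᶠ T ∈ newtonPolygon K f, bracket S T

/-- `k`: the exponent of the highest power of `x` dividing `f`. -/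
def kdiv (f : PS K) : ℕ := sInf {a : ℕ | ∃ b : ℕ, (a, b) ∈ supp K f}

/-- `l`: the exponent of the highest power of `y` dividing `f`. -/
def ldiv (f : PS K) : ℕ := sInf {b : ℕ | ∃ a : ℕ, (a, b) ∈ supp K f}

/-- `r(N_f) = Σ_{S ∈ N_f} r(S) + k + l`, where `x^k y^l` is the monomial of highest degree
dividing `f`. -/
def rNewton (f : PS K) : ℕ := (∑ᶠ S ∈ newtonPolygon K f, S.rE) + kdiv K f + ldiv K f

/-- `μ(N_f) = [N_f,N_f] - |N_f|₁ - |N_f|₂ + 1` (the Newton number of a convenient series). -/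
def muNewtonConv (f : PS K) : ℤ :=
  (bracketN K f : ℤ) - (len1N K f : ℤ) - (len2N K f : ℤ) + 1

/-- `μ(N_f) = sup_{m ∈ ℕ} μ(N_{f + x^m + y^m})`: the Newton number of an arbitrary
(reduced) power series. -/
def muNewton (f : PS K) : ℤ :=
  sSup {z : ℤ | ∃ m : ℕ, z = muNewtonConv K (f + Xv K ^ m + Yv K ^ m)}

/-- `δ(N_f) = (μ(N_f) + r(N_f) - 1)/2`. -/
def deltaNewton (f : PS K) : ℤ := (muNewton K f + (rNewton K f : ℤ) - 1) / 2

/-- `in(f,S) = Σ_{(α,β) ∈ S} c_{αβ} x^α y^β`, the initial part of `f` along the edge `S`. -/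
def initialForm (f : PS K) (S : NEdge) : PS K :=
  ofCoef K fun p => if S.mem p then coef K f p else 0

/-- `ī(f,S)`: the convenient power series with `in(f,S) = x^{α(S)} y^{β(S)} ī(f,S)`,
where `x^{α(S)} y^{β(S)}` is the monomial of highest degree dividing `in(f,S)`. -/
def inBar (f : PS K) (S : NEdge) : PS K :=
  ofCoef K fun p =>
    if S.mem (p.1 + S.A.1, p.2 + S.B.2) then coef K f (p.1 + S.A.1, p.2 + S.B.2) else 0

/-- `f` is non-degenerate (in the sense of Beelen–Pellikaan) if `ī(f,S)` is reduced
(i.e. squarefree) for every edge `S ∈ N_f`. -/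
def NonDegenerate (f : PS K) : Prop :=
  ∀ S ∈ newtonPolygon K f, Squarefree (inBar K f S)

/-- `f` is elementary if it is convenient and `N_f` consists of a single edge. -/
def Elementary (f : PS K) : Prop :=
  Convenient K f ∧ ∃ S : NEdge, newtonPolygon K f = {S}

/-- Evaluation of a power series with finite support (e.g. an initial form) at a point of `K²`. -/
def psEval (f : PS K) (v : K × K) : K :=
  ∑ᶠ p : ℕ × ℕ, coef K f p * v.1 ^ p.1 * v.2 ^ p.2

/-- The partial derivative `∂f/∂x` (for `i = 0`) resp. `∂f/∂y` (for `i = 1`). -/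
def pderivSeries (i : Fin 2) (f : PS K) : PS K :=
  ofCoef K fun p =>
    if i = 0 then ((p.1 + 1 : ℕ) : K) * coef K f (p.1 + 1, p.2)
    else ((p.2 + 1 : ℕ) : K) * coef K f (p.1, p.2 + 1)

/-- `μ(f) = i₀(∂f/∂x, ∂f/∂y)`, the Milnor number of `f`. -/
def milnor (f : PS K) : ℕ := iMult K (pderivSeries K 0 f) (pderivSeries K 1 f)

/-- `f` is strongly non-degenerate (Kouchnirenko) if for every `S ∈ N_f` the solutions of
`∂in(f,S)/∂x = ∂in(f,S)/∂y = 0` are contained in `{xy = 0}`. -/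
def StronglyNonDegenerate (f : PS K) : Prop :=
  ∀ S ∈ newtonPolygon K f, ∀ v : K × K,
    psEval K (pderivSeries K 0 (initialForm K f S)) v = 0 →
    psEval K (pderivSeries K 1 (initialForm K f S)) v = 0 → v.1 * v.2 = 0

/-- The Newton diagram `Δ(f) ⊆ ℝ²`: the convex hull of `supp f + (ℝ_{≥0})²`. -/
def diagram (f : PS K) : Set (ℝ × ℝ) :=
  convexHull ℝ {q : ℝ × ℝ | ∃ p ∈ supp K f, (p.1 : ℝ) ≤ q.1 ∧ (p.2 : ℝ) ≤ q.2}

/-- A real point lies on the Newton polygon `N_f` (i.e. on a compact face of the boundary of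
the Newton diagram) iff it belongs to the diagram and some linear form with positive
coefficients attains its minimum over the diagram at this point. -/
def OnNewtonPolygon (f : PS K) (q : ℝ × ℝ) : Prop :=
  q ∈ diagram K f ∧ ∃ w : ℝ × ℝ, 0 < w.1 ∧ 0 < w.2 ∧
    ∀ p ∈ diagram K f, w.1 * q.1 + w.2 * q.2 ≤ w.1 * p.1 + w.2 * p.2

section Filtration

open MvPowerSeries

variable {K}

/-- The ideal of power series of weighted order at least `k`. -/
def weightedIdeal (w : Fin 2 → ℕ) (k : ℕ) : Ideal (PS K) where
  carrier := {h | (k : ℕ∞) ≤ h.weightedOrder w}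
  zero_mem' := by simp
  add_mem' ha hb := (le_min ha hb).trans (min_weightedOrder_le_add w)
  smul_mem' c h hh := by
    refine le_trans ?_ (le_weightedOrder_mul w)
    exact le_trans hh le_add_self

lemma mem_weightedIdeal {w : Fin 2 → ℕ} {k : ℕ} {h : PS K} :
    h ∈ weightedIdeal w k ↔ (k : ℕ∞) ≤ h.weightedOrder w := Iff.rfl

lemma mem_weightedIdeal_iff_coeff {w : Fin 2 → ℕ} {k : ℕ} {h : PS K} :
    h ∈ weightedIdeal w k ↔ ∀ d, Finsupp.weight w d < k → coeff d h = 0 := by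
  refine ⟨fun hh d hd => coeff_eq_zero_of_lt_weightedOrder w ?_,
    fun hh => nat_le_weightedOrder w hh⟩
  exact lt_of_lt_of_le (by exact_mod_cast hd) hh

lemma weightedIdeal_anti (w : Fin 2 → ℕ) {k l : ℕ} (hkl : k ≤ l) :
    (weightedIdeal w l : Ideal (PS K)) ≤ weightedIdeal w k := fun _ hh =>
  mem_weightedIdeal.2 (le_trans (by exact_mod_cast hkl) (mem_weightedIdeal.1 hh))

lemma mul_mem_weightedIdeal {w : Fin 2 → ℕ} {k l t : ℕ} {a b : PS K}
    (ha : a ∈ weightedIdeal w k) (hb : b ∈ weightedIdeal w l) (ht : t ≤ k + l) :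
    a * b ∈ weightedIdeal w t := by
  refine weightedIdeal_anti w ht ?_
  rw [mem_weightedIdeal, weightedOrder_mul, Nat.cast_add]
  exact add_le_add ha hb

/-- The weighted order is additive, so a factor of order `d` can be cancelled. -/
lemma mem_weightedIdeal_of_mul {w : Fin 2 → ℕ} {k d : ℕ} {c f : PS K}
    (hf : f.weightedOrder w = d) (h : c * f ∈ weightedIdeal w k) :
    c ∈ weightedIdeal w (k - d) := by
  rw [mem_weightedIdeal, weightedOrder_mul, hf] at h
  rw [mem_weightedIdeal, ENat.natCast_sub]
  exact tsub_le_iff_right.2 h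

lemma weight_eq (w : Fin 2 → ℕ) (d : Fin 2 →₀ ℕ) :
    Finsupp.weight w d = d 0 * w 0 + d 1 * w 1 := by
  simp [Finsupp.weight_eq_sum]

lemma single_add_single_eq_iff {a b : ℕ} {d : Fin 2 →₀ ℕ} :
    Finsupp.single 0 a + Finsupp.single 1 b = d ↔ d 0 = a ∧ d 1 = b := by
  constructor
  · rintro rfl
    simp
  · rintro ⟨rfl, rfl⟩
    ext i
    fin_cases i <;> simp

lemma coeff_eq_coef (h : PS K) (d : Fin 2 →₀ ℕ) : coeff d h = coef K h (d 0, d 1) := by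
  rw [coef, single_add_single_eq_iff.2 ⟨rfl, rfl⟩]

lemma X_pow_dvd_iff_mem (k : ℕ) (h : PS K) :
    (X 0 : PS K) ^ k ∣ h ↔ h ∈ weightedIdeal ![1, 0] k := by
  rw [X_pow_dvd_iff, mem_weightedIdeal_iff_coeff]
  simp [weight_eq]

/-- If `f` is not divisible by `x`, then `x ^ k` can be cancelled from `f ∣ x ^ k * b`. -/
lemma dvd_of_dvd_X_pow_mul {f b : PS K} {n k : ℕ} (hf : coef K f (0, n) ≠ 0)
    (h : f ∣ (X 0 : PS K) ^ k * b) : f ∣ b := by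
  obtain ⟨c, hc⟩ := h
  have hord : f.weightedOrder ![1, 0] = ((0 : ℕ) : ℕ∞) := by
    refine le_antisymm ?_ (by simp)
    refine (weightedOrder_le _ hf).trans ?_
    simp [weight_eq]
  have hmem : c * f ∈ weightedIdeal ![1, 0] k :=
    (X_pow_dvd_iff_mem _ _).1 ⟨b, by rw [hc, mul_comm]⟩
  obtain ⟨c', rfl⟩ := (X_pow_dvd_iff_mem _ _).2 (mem_weightedIdeal_of_mul hord hmem)
  refine ⟨c', ?_⟩
  have hX : (X 0 : PS K) ^ k ≠ 0 := fun h0 => by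
    simpa [X_pow_eq] using congrArg (coeff (Finsupp.single 0 k)) h0
  apply mul_left_cancel₀ hX
  rw [hc]
  simp only [tsub_zero]
  ring

/-- Weighted homogeneous components for positive weights are polynomials. -/
lemma exists_polynomial_component {w : Fin 2 → ℕ} (hw : ∀ i, w i ≠ 0) (t : ℕ) (h : PS K) :
    ∃ P : MvPolynomial (Fin 2) K, (P : PS K) = weightedHomogeneousComponent w t h := by
  refine ⟨truncFinset K (Finsupp.finite_of_nat_weight_eq w hw t).toFinset h, ?_⟩
  ext d
  rw [MvPolynomial.coeff_coe, coeff_truncFinset, coeff_weightedHomogeneousComponent]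
  simp

lemma psEval_coe (P : MvPolynomial (Fin 2) K) (v : K × K) :
    psEval K (P : PS K) v = MvPolynomial.eval ![v.1, v.2] P := by
  let e : (Fin 2 →₀ ℕ) ≃ ℕ × ℕ := 
    { toFun := fun d => (d 0, d 1)
      invFun := fun p => Finsupp.single 0 p.1 + Finsupp.single 1 p.2
      left_inv := fun d => single_add_single_eq_iff.2 ⟨rfl, rfl⟩
      right_inv := fun p => by simp }
  rw [psEval, ← finsum_comp_equiv e, MvPolynomial.eval_eq']
  have key : ∀ d, coef K (P : PS K) (e d) * v.1 ^ (e d).1 * v.2 ^ (e d).2 =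
      P.coeff d * ∏ i, ![v.1, v.2] i ^ d i := by
    intro d
    rw [show coef K (P : PS K) (e d) = P.coeff d by
      rw [← MvPolynomial.coeff_coe, coeff_eq_coef]; rfl]
    simp [e, Fin.prod_univ_two, mul_assoc]
  simp_rw [key]
  refine finsum_eq_sum_of_support_subset _ ?_
  intro d hd
  simp only [Function.mem_support, ne_eq, Finset.mem_coe, MvPolynomial.mem_support_iff] at hd ⊢
  exact left_ne_zero_of_mul hd

lemma sub_component_mem {w : Fin 2 → ℕ} {t : ℕ} {h : PS K} (hh : h ∈ weightedIdeal w t) :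
    h - weightedHomogeneousComponent w t h ∈ weightedIdeal w (t + 1) := by
  rw [mem_weightedIdeal_iff_coeff] at hh ⊢
  intro d hd
  rw [map_sub, coeff_weightedHomogeneousComponent]
  split_ifs with h1
  · simp
  · rw [hh d (by omega), sub_zero]

end Filtration

section Exactness

open MvPowerSeries

variable {K}

/-- Exactness at level `k` of the truncated Koszul complex of `f` and `g`. -/
def KoszulExact (w : Fin 2 → ℕ) (d e : ℕ) (f g : PS K) (k : ℕ) : Prop :=
  ∀ a b : PS K, a * f + b * g ∈ weightedIdeal w k →
    ∃ c : PS K, a - c * g ∈ weightedIdeal w (k - d) ∧ b + c * f ∈ weightedIdeal w (k - e)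

lemma component_homogeneous_mem (w : Fin 2 → ℕ) (t : ℕ) (h : PS K) :
    weightedHomogeneousComponent w t h ∈ weightedIdeal w t := by
  rw [mem_weightedIdeal_iff_coeff]
  intro d hd
  rw [coeff_weightedHomogeneousComponent, if_neg hd.ne]

/-- The part of `a` that contributes in weight `s` to the product of `a` with a series of
order `d`. -/
lemma exists_leading_part {w : Fin 2 → ℕ} {d s : ℕ} {a f : PS K}
    (ha : a ∈ weightedIdeal w (s - d)) (hf : f ∈ weightedIdeal w d) :
    ∃ α : PS K, α ∈ weightedIdeal w (s - d) ∧ a - α ∈ weightedIdeal w (s + 1 - d) ∧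
      weightedHomogeneousComponent w s (a * f) = α * weightedHomogeneousComponent w d f := by
  by_cases hds : d ≤ s
  · refine ⟨weightedHomogeneousComponent w (s - d) a, component_homogeneous_mem _ _ _, ?_, ?_⟩
    · rw [Nat.sub_add_comm hds]
      exact sub_component_mem ha
    · rw [← weightedHomogeneousComponent_mul_of_le_weightedOrder ha hf, Nat.sub_add_cancel hds]
  · refine ⟨0, zero_mem _, ?_, ?_⟩
    · rw [show s + 1 - d = s - d by omega, sub_zero]
      exact ha
    · rw [zero_mul]
      apply weightedHomogeneousComponent_of_lt_weightedOrder_eq_zero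
      have := mul_mem_weightedIdeal ha hf (t := s + 1) (by omega)
      exact lt_of_lt_of_le (by exact_mod_cast Nat.lt_succ_self s) (mem_weightedIdeal.1 this)

lemma koszulExact_of_syzygy {w : Fin 2 → ℕ} {d e : ℕ} {f g : PS K}
    (hf : f ∈ weightedIdeal w d) (hg : g ∈ weightedIdeal w e)
    (hF : (weightedHomogeneousComponent w d f).weightedOrder w = d)
    (hsyz : ∀ α β : PS K, α * weightedHomogeneousComponent w d f +
        β * weightedHomogeneousComponent w e g = 0 →
      ∃ c : PS K, α = c * weightedHomogeneousComponent w e g ∧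
        β = - c * weightedHomogeneousComponent w d f) (k : ℕ) :
    KoszulExact w d e f g k := by
  intro a b hab
  suffices h : ∀ s ≤ k, ∃ c : PS K, a - c * g ∈ weightedIdeal w (s - d) ∧
      b + c * f ∈ weightedIdeal w (s - e) from h k le_rfl
  intro s
  induction s with
  | zero =>
    intro _
    refine ⟨0, ?_, ?_⟩ <;> simp [mem_weightedIdeal]
  | succ s ih =>
    intro hs
    obtain ⟨c, ha, hb⟩ := ih (by omega)
    obtain ⟨α, hα, haα, hαF⟩ := exists_leading_part ha hf
    obtain ⟨β, hβ, hbβ, hβG⟩ := exists_leading_part hb hg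
    have hzero : weightedHomogeneousComponent w s (a * f + b * g) = 0 := by
      apply weightedHomogeneousComponent_of_lt_weightedOrder_eq_zero
      exact lt_of_lt_of_le (by exact_mod_cast hs) (mem_weightedIdeal.1 hab)
    have hrel : a * f + b * g = (a - c * g) * f + (b + c * f) * g := by ring
    rw [hrel, map_add, hαF, hβG] at hzero
    obtain ⟨c', hc1, hc2⟩ := hsyz α β hzero
    have hc' : c' ∈ weightedIdeal w (s - e - d) := by
      refine mem_weightedIdeal_of_mul hF ?_
      have : c' * weightedHomogeneousComponent w d f = -β := by rw [hc2]; ring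
      rw [this]
      exact neg_mem hβ
    refine ⟨c + c', ?_, ?_⟩
    · have : a - (c + c') * g = (a - c * g - α) -
          c' * (g - weightedHomogeneousComponent w e g) := by rw [hc1]; ring
      rw [this]
      exact sub_mem haα (mul_mem_weightedIdeal hc' (sub_component_mem hg) (by omega))
    · have : b + (c + c') * f = (b + c * f - β) +
          c' * (f - weightedHomogeneousComponent w d f) := by rw [hc2]; ring
      rw [this]
      exact add_mem hbβ (mul_mem_weightedIdeal hc' (sub_component_mem hf) (by omega))

/-- Forms with no common zero besides the origin have only the trivial syzygies. -/
lemma syzygy_of_no_common_zero [IsAlgClosed K] {F G : MvPolynomial (Fin 2) K} {n : ℕ}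
    (hF : coef K (F : PS K) (0, n) ≠ 0)
    (hz : ∀ v : K × K, psEval K (F : PS K) v = 0 → psEval K (G : PS K) v = 0 → v = (0, 0))
    (α β : PS K) (h : α * (F : PS K) + β * (G : PS K) = 0) :
    ∃ c : PS K, α = c * (G : PS K) ∧ β = - c * (F : PS K) := by
  have hrad : (MvPolynomial.X 0 : MvPolynomial (Fin 2) K) ∈ (Ideal.span {F, G}).radical := by
    rw [← MvPolynomial.vanishingIdeal_zeroLocus_eq_radical (K := K),
      MvPolynomial.mem_vanishingIdeal_iff]
    intro x hx
    rw [MvPolynomial.mem_zeroLocus_iff] at hx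
    have hx1 := hx F (Ideal.subset_span (by simp))
    have hx2 := hx G (Ideal.subset_span (by simp))
    have hxe : x = ![x 0, x 1] := by ext i; fin_cases i <;> rfl
    rw [MvPolynomial.aeval_eq_eval, hxe] at hx1 hx2
    have := hz (x 0, x 1) (by rw [psEval_coe]; exact hx1) (by rw [psEval_coe]; exact hx2)
    simpa using congrArg Prod.fst this
  obtain ⟨N, hN⟩ := hrad
  obtain ⟨u, v, huv⟩ := Ideal.mem_span_pair.1 hN
  have huv' : (u : PS K) * F + v * G = (X 0 : PS K) ^ N := by
    rw [← MvPolynomial.coe_X, ← MvPolynomial.coe_pow, ← huv, MvPolynomial.coe_add,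
      MvPolynomial.coe_mul, MvPolynomial.coe_mul]
  obtain ⟨c, hc⟩ := dvd_of_dvd_X_pow_mul (k := N) (b := β) hF
    ⟨u * β - v * α, by rw [← huv']; linear_combination (v : PS K) * h⟩
  refine ⟨-c, ?_, by rw [hc]; ring⟩
  have hF0 : (F : PS K) ≠ 0 := by
    rintro h0
    rw [h0] at hF
    exact hF (by simp [coef])
  apply mul_right_cancel₀ hF0
  rw [hc] at h
  linear_combination h

end Exactness

section Counting

/-- The lattice points of `ℕ²` on which the linear form `(n, m)` is less than `k`. -/
def latticePoints (n m k : ℕ) : Finset (ℕ × ℕ) :=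
  (Finset.range k ×ˢ Finset.range k).filter fun p => n * p.1 + m * p.2 < k

lemma mem_latticePoints {n m k : ℕ} (hn : 0 < n) (hm : 0 < m) {p : ℕ × ℕ} :
    p ∈ latticePoints n m k ↔ n * p.1 + m * p.2 < k := by
  simp only [latticePoints, Finset.mem_filter, Finset.mem_product, Finset.mem_range,
    and_iff_right_iff_imp]
  intro h
  constructor <;> nlinarith

lemma card_latticePoints_swap (n m k : ℕ) :
    (latticePoints n m k).card = (latticePoints m n k).card := by
  refine Finset.card_equiv (Equiv.prodComm ℕ ℕ) fun p => ?_
  simp only [latticePoints, Finset.mem_filter, Finset.mem_product, Finset.mem_range,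
    Equiv.prodComm_apply, Prod.fst_swap, Prod.snd_swap]
  rw [and_comm (a := p.1 < k), add_comm]

lemma card_latticePoints_shift_fst {n m : ℕ} (hn : 0 < n) (hm : 0 < m) (r k : ℕ) :
    (latticePoints n m k).card = (latticePoints n m (k - n * r)).card +
      ((latticePoints n m k).filter fun p => p.1 < r).card := by
  rw [← Finset.card_filter_add_card_filter_not (s := latticePoints n m k) (fun p => p.1 < r),
    add_comm]
  congr 1
  symm
  refine Finset.card_bij (fun p _ => (p.1 + r, p.2)) ?_ ?_ ?_
  · intro p hp
    simp only [Finset.mem_filter, mem_latticePoints hn hm] at hp ⊢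
    refine ⟨?_, by omega⟩
    rw [mul_add]
    omega
  · intro p _ q _ h
    simp only [Prod.mk.injEq, Nat.add_right_cancel_iff] at h
    exact Prod.ext h.1 h.2
  · intro p hp
    simp only [Finset.mem_filter, mem_latticePoints hn hm, not_lt] at hp
    refine ⟨(p.1 - r, p.2), ?_, ?_⟩
    · rw [mem_latticePoints hn hm]
      have : n * p.1 = n * (p.1 - r) + n * r := by rw [← mul_add, Nat.sub_add_cancel hp.2]
      dsimp only
      omega
    · rw [Nat.sub_add_cancel hp.2]

lemma card_latticePoints_strip_shift {n m : ℕ} (hn : 0 < n) (hm : 0 < m) {r q k : ℕ}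
    (hk : n * r + m * q ≤ k) :
    ((latticePoints n m k).filter fun p => p.1 < r).card =
      ((latticePoints n m (k - m * q)).filter fun p => p.1 < r).card + r * q := by
  rw [← Finset.card_filter_add_card_filter_not
    (s := (latticePoints n m k).filter fun p => p.1 < r) (fun p => p.2 < q), add_comm]
  congr 1
  · symm
    refine Finset.card_bij (fun p _ => (p.1, p.2 + q)) ?_ ?_ ?_
    · intro p hp
      simp only [Finset.mem_filter, mem_latticePoints hn hm] at hp ⊢
      refine ⟨⟨?_, hp.2⟩, by omega⟩
      rw [mul_add]
      omega
    · intro p _ q _ h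
      simp only [Prod.mk.injEq, Nat.add_right_cancel_iff] at h
      exact Prod.ext h.1 h.2
    · intro p hp
      simp only [Finset.mem_filter, mem_latticePoints hn hm, not_lt] at hp
      refine ⟨(p.1, p.2 - q), ?_, ?_⟩
      · rw [Finset.mem_filter, mem_latticePoints hn hm]
        have : m * p.2 = m * (p.2 - q) + m * q := by rw [← mul_add, Nat.sub_add_cancel hp.2]
        dsimp only
        omega
      · rw [Nat.sub_add_cancel hp.2]
  · rw [show r * q = (Finset.range r ×ˢ Finset.range q).card by simp]
    congr 1
    ext p
    simp only [Finset.mem_filter, mem_latticePoints hn hm, Finset.mem_product, Finset.mem_range]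
    refine ⟨fun h => ⟨h.1.2, h.2⟩, fun h => ⟨⟨?_, h.1⟩, h.2⟩⟩
    have h1 := Nat.mul_lt_mul_of_pos_left h.1 hn
    have h2 := Nat.mul_lt_mul_of_pos_left h.2 hm
    omega

lemma card_latticePoints_of_dvd {n m e k : ℕ} (hn : 0 < n) (hm : 0 < m) (he : m ∣ e)
    (hk : n * m + e ≤ k) :
    (latticePoints n m k).card + (latticePoints n m (k - e - n * m)).card =
      (latticePoints n m (k - n * m)).card + (latticePoints n m (k - e)).card + e := by
  obtain ⟨q, rfl⟩ := he
  have h1 := card_latticePoints_shift_fst hn hm m k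
  have h2 := card_latticePoints_shift_fst hn hm m (k - m * q)
  have h3 := card_latticePoints_strip_shift hn hm hk
  omega

/-- Second difference of the number of lattice points in a triangle. -/
lemma card_latticePoints_second_difference {n m e k : ℕ} (hn : 0 < n) (hm : 0 < m)
    (he : m ∣ e ∨ n ∣ e) (hk : n * m + e ≤ k) :
    (latticePoints n m k).card + (latticePoints n m (k - e - n * m)).card =
      (latticePoints n m (k - n * m)).card + (latticePoints n m (k - e)).card + e := by
  rcases he with he | he
  · exact card_latticePoints_of_dvd hn hm he hk
  · have := card_latticePoints_of_dvd (k := k) hm hn he (by rwa [mul_comm m n])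
    simpa only [card_latticePoints_swap m n, mul_comm m n] using this

end Counting

section Dimension

open MvPowerSeries

variable {K}

/-- Restriction of the coefficients of a power series to a finite set of exponents. -/
def coefRestrict (s : Finset (ℕ × ℕ)) : PS K →ₗ[K] (s → K) where
  toFun h p := coef K h p
  map_add' a b := by ext p; simp [coef]
  map_smul' c a := by ext p; simp [coef]

lemma coefRestrict_surjective (s : Finset (ℕ × ℕ)) :
    Function.Surjective (coefRestrict (K := K) s) := by
  intro c
  refine ⟨ofCoef K fun p => if hp : p ∈ s then c ⟨p, hp⟩ else 0, ?_⟩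
  ext ⟨p, hp⟩
  simp [coefRestrict, coef, ofCoef, MvPowerSeries.coeff_apply, hp]

lemma ker_coefRestrict {n m : ℕ} (hn : 0 < n) (hm : 0 < m) (k : ℕ) :
    LinearMap.ker (coefRestrict (K := K) (latticePoints n m k)) =
      (weightedIdeal ![n, m] k).restrictScalars K := by
  ext h
  rw [LinearMap.mem_ker, Submodule.restrictScalars_mem, mem_weightedIdeal_iff_coeff]
  constructor
  · intro hh d hd
    rw [coeff_eq_coef]
    refine congrFun hh ⟨(d 0, d 1), ?_⟩
    rw [mem_latticePoints hn hm]
    simpa [weight_eq, mul_comm] using hd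
  · intro hh
    ext ⟨p, hp⟩
    rw [mem_latticePoints hn hm] at hp
    refine hh _ ?_
    simpa [weight_eq, mul_comm] using hp

/-- The quotient by `weightedIdeal` has the monomials of small weight as a basis. -/
def quotientWeightedIdealEquiv {n m : ℕ} (hn : 0 < n) (hm : 0 < m) (k : ℕ) :
    (PS K ⧸ (weightedIdeal ![n, m] k : Ideal (PS K))) ≃ₗ[K] (latticePoints n m k → K) :=
  (Submodule.Quotient.restrictScalarsEquiv K _).symm ≪≫ₗ
    Submodule.quotEquivOfEq _ _ (ker_coefRestrict hn hm k).symm ≪≫ₗ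
      LinearMap.quotKerEquivOfSurjective _ (coefRestrict_surjective _)

lemma finrank_quotient_weightedIdeal {n m : ℕ} (hn : 0 < n) (hm : 0 < m) (k : ℕ) :
    Module.finrank K (PS K ⧸ (weightedIdeal ![n, m] k : Ideal (PS K))) =
      (latticePoints n m k).card := by
  rw [(quotientWeightedIdealEquiv hn hm k).finrank_eq]
  simp

lemma finite_quotient_weightedIdeal {n m : ℕ} (hn : 0 < n) (hm : 0 < m) (k : ℕ) :
    Module.Finite K (PS K ⧸ (weightedIdeal ![n, m] k : Ideal (PS K))) :=
  Module.Finite.equiv (quotientWeightedIdealEquiv hn hm k).symm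

end Dimension

section KoszulDimension

open MvPowerSeries

variable {K}

/-- Multiplication by a series of order at least `d`, between truncations. -/
def truncMul (w : Fin 2 → ℕ) {d k l : ℕ} {f : PS K} (hf : f ∈ weightedIdeal w d)
    (hkl : k ≤ l + d) :
    (PS K ⧸ (weightedIdeal w l : Ideal (PS K))) →ₗ[PS K]
      PS K ⧸ (weightedIdeal w k : Ideal (PS K)) :=
  Submodule.mapQ _ _ (LinearMap.mulRight (PS K) f) fun _ ha => mul_mem_weightedIdeal ha hf hkl

/-- The truncated quotient by `(f, g)` has dimension at least `e`, and exactly `e` if and only if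
the truncated Koszul complex is exact. -/
lemma finrank_quotient_sup {n m e k : ℕ} {f g : PS K} (hn : 0 < n) (hm : 0 < m)
    (hf : f.weightedOrder ![n, m] = (n * m : ℕ)) (hg : g ∈ weightedIdeal ![n, m] e)
    (he : m ∣ e ∨ n ∣ e) (hk : n * m + e ≤ k) :
    e ≤ Module.finrank K (PS K ⧸ (Ideal.span {f, g} ⊔ weightedIdeal ![n, m] k)) ∧
    (Module.finrank K (PS K ⧸ (Ideal.span {f, g} ⊔ weightedIdeal ![n, m] k)) = e ↔
      KoszulExact ![n, m] (n * m) e f g k) := by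
  set w : Fin 2 → ℕ := ![n, m] with hw
  set d := n * m with hd
  have hf' : f ∈ weightedIdeal w d := mem_weightedIdeal.2 hf.ge
  have := fun l => finite_quotient_weightedIdeal (K := K) hn hm l
  let φ := (truncMul w (k := k - d) (l := k - e - d) hg (by omega)).prod
    (truncMul w (k := k - e) (l := k - e - d) (neg_mem hf') (by omega))
  let ψ := (truncMul w (k := k) (l := k - d) hf' (by omega)).coprod
    (truncMul w (k := k) (l := k - e) hg (by omega))
  let q : (PS K ⧸ (weightedIdeal w k : Ideal (PS K))) →ₗ[PS K]
      PS K ⧸ (Ideal.span {f, g} ⊔ weightedIdeal w k) := Submodule.factor le_sup_right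
  have hψ : ∀ a b : PS K, ψ (Submodule.Quotient.mk a, Submodule.Quotient.mk b) =
      Submodule.Quotient.mk (a * f + b * g) := fun a b => rfl
  have hφ : ∀ c : PS K, φ (Submodule.Quotient.mk c) =
      (Submodule.Quotient.mk (c * g), Submodule.Quotient.mk (c * -f)) := fun c => rfl
  have hq : ∀ a : PS K, q (Submodule.Quotient.mk a) = Submodule.Quotient.mk a := fun a => rfl
  have hφinj : Function.Injective (φ.restrictScalars K) := by
    rw [injective_iff_map_eq_zero]
    intro x
    obtain ⟨c, rfl⟩ := Submodule.Quotient.mk_surjective _ x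
    intro hc
    have hc2 := congrArg Prod.snd ((hφ c).symm.trans hc)
    simp only [Prod.snd_zero, Submodule.Quotient.mk_eq_zero] at hc2 ⊢
    refine mem_weightedIdeal_of_mul hf ?_
    simpa using neg_mem hc2
  have hqsurj : LinearMap.range (q.restrictScalars K) = ⊤ := by
    rw [LinearMap.range_eq_top]
    intro x
    obtain ⟨a, rfl⟩ := Submodule.Quotient.mk_surjective _ x
    exact ⟨Submodule.Quotient.mk a, hq a⟩
  have hexact : LinearMap.ker (q.restrictScalars K) = LinearMap.range (ψ.restrictScalars K) := by
    ext x
    obtain ⟨a, rfl⟩ := Submodule.Quotient.mk_surjective _ x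
    rw [LinearMap.mem_ker, LinearMap.mem_range, LinearMap.restrictScalars_apply, hq,
      Submodule.Quotient.mk_eq_zero, Submodule.mem_sup]
    constructor
    · rintro ⟨y, hy, z, hz, rfl⟩
      obtain ⟨u, v, rfl⟩ := Ideal.mem_span_pair.1 hy
      refine ⟨(Submodule.Quotient.mk u, Submodule.Quotient.mk v), ?_⟩
      rw [LinearMap.restrictScalars_apply, hψ, Submodule.Quotient.eq]
      simpa using neg_mem hz
    · rintro ⟨⟨x, y⟩, hxy⟩
      obtain ⟨u, rfl⟩ := Submodule.Quotient.mk_surjective _ x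
      obtain ⟨v, rfl⟩ := Submodule.Quotient.mk_surjective _ y
      rw [LinearMap.restrictScalars_apply, hψ, Submodule.Quotient.eq] at hxy
      refine ⟨u * f + v * g, Ideal.mem_span_pair.2 ⟨u, v, rfl⟩, a - (u * f + v * g), ?_, by ring⟩
      rw [← neg_sub]
      exact neg_mem hxy
  have hcomplex : LinearMap.range (φ.restrictScalars K) ≤ LinearMap.ker (ψ.restrictScalars K) := by
    rintro _ ⟨x, rfl⟩
    obtain ⟨c, rfl⟩ := Submodule.Quotient.mk_surjective _ x
    rw [LinearMap.mem_ker, LinearMap.restrictScalars_apply, LinearMap.restrictScalars_apply, hφ,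
      hψ, show c * g * f + c * -f * g = 0 by ring, Submodule.Quotient.mk_zero]
  have hkoszul : LinearMap.ker (ψ.restrictScalars K) ≤ LinearMap.range (φ.restrictScalars K) ↔
      KoszulExact w d e f g k := by
    constructor
    · intro h a b hab
      obtain ⟨x, hx⟩ := @h (Submodule.Quotient.mk a, Submodule.Quotient.mk b) (by
        rw [LinearMap.mem_ker, LinearMap.restrictScalars_apply, hψ,
          Submodule.Quotient.mk_eq_zero]
        exact hab)
      obtain ⟨c, rfl⟩ := Submodule.Quotient.mk_surjective _ x
      rw [LinearMap.restrictScalars_apply, hφ, Prod.mk.injEq, Submodule.Quotient.eq,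
        Submodule.Quotient.eq] at hx
      refine ⟨c, ?_, ?_⟩
      · rw [← neg_sub]
        exact neg_mem hx.1
      · rw [show b + c * f = -(c * -f - b) by ring]
        exact neg_mem hx.2
    · rintro h ⟨x, y⟩ hxy
      obtain ⟨a, rfl⟩ := Submodule.Quotient.mk_surjective _ x
      obtain ⟨b, rfl⟩ := Submodule.Quotient.mk_surjective _ y
      rw [LinearMap.mem_ker, LinearMap.restrictScalars_apply, hψ,
        Submodule.Quotient.mk_eq_zero] at hxy
      obtain ⟨c, hc1, hc2⟩ := h a b hxy
      refine ⟨Submodule.Quotient.mk c, ?_⟩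
      rw [LinearMap.restrictScalars_apply, hφ, Prod.mk.injEq, Submodule.Quotient.eq,
        Submodule.Quotient.eq]
      refine ⟨?_, ?_⟩
      · rw [← neg_sub]
        exact neg_mem hc1
      · rw [show c * -f - b = -(b + c * f) by ring]
        exact neg_mem hc2
  have dim1 := (q.restrictScalars K).finrank_range_add_finrank_ker
  have dim2 := (ψ.restrictScalars K).finrank_range_add_finrank_ker
  have dim3 := LinearMap.finrank_range_of_inj hφinj
  have dim4 := Submodule.finrank_mono hcomplex
  rw [hqsurj, finrank_top, hexact, finrank_quotient_weightedIdeal hn hm] at dim1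
  rw [Module.finrank_prod, finrank_quotient_weightedIdeal hn hm,
    finrank_quotient_weightedIdeal hn hm] at dim2
  rw [finrank_quotient_weightedIdeal hn hm] at dim3
  have count := card_latticePoints_second_difference hn hm he hk
  rw [← hd] at count
  refine ⟨by omega, ?_⟩
  rw [← hkoszul]
  constructor
  · intro h
    exact (Submodule.eq_of_le_of_finrank_le hcomplex (by omega)).ge
  · intro h
    have := Submodule.finrank_mono h
    omega

end KoszulDimension

section WeightedMultiplicity

open MvPowerSeries

variable {K}

lemma finite_quotient_of_le {I J : Ideal (PS K)} (hIJ : I ≤ J) [Module.Finite K (PS K ⧸ I)] :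
    Module.Finite K (PS K ⧸ J) :=
  Module.Finite.of_surjective ((Submodule.factor hIJ).restrictScalars K)
    (Submodule.factor_surjective hIJ)

lemma rank_quotient_le_of_le {I J : Ideal (PS K)} (hIJ : I ≤ J) :
    Module.rank K (PS K ⧸ J) ≤ Module.rank K (PS K ⧸ I) :=
  LinearMap.rank_le_of_surjective ((Submodule.factor hIJ).restrictScalars K)
    (Submodule.factor_surjective hIJ)

lemma le_of_finrank_quotient_eq {I J : Ideal (PS K)} (hIJ : I ≤ J) [Module.Finite K (PS K ⧸ I)]
    (h : Module.finrank K (PS K ⧸ I) = Module.finrank K (PS K ⧸ J)) : J ≤ I := by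
  have := finite_quotient_of_le hIJ
  have hinj := (LinearMap.injective_iff_surjective_of_finrank_eq_finrank
    (f := (Submodule.factor hIJ).restrictScalars K) h).2 (Submodule.factor_surjective hIJ)
  intro a ha
  rw [← Submodule.Quotient.mk_eq_zero I]
  apply hinj
  rw [map_zero]
  exact (Submodule.Quotient.mk_eq_zero J).2 ha

lemma weightedIdeal_le_span_pow {n m A B k : ℕ} (hn : 0 < n) (hm : 0 < m)
    (hk : n * A + m * B ≤ k) :
    (weightedIdeal ![n, m] k : Ideal (PS K)) ≤ Ideal.span {(X 0 : PS K) ^ A, (X 1 : PS K) ^ B} := by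
  intro h hh
  rw [mem_weightedIdeal_iff_coeff] at hh
  let h₁ : PS K := fun d => if A ≤ d 0 then coeff d h else 0
  have hc : ∀ d, coeff d h₁ = if A ≤ d 0 then coeff d h else 0 := fun d => rfl
  obtain ⟨a, ha⟩ : (X 0 : PS K) ^ A ∣ h₁ := by
    rw [X_pow_dvd_iff]
    intro d hd
    rw [hc, if_neg (by omega)]
  obtain ⟨b, hb⟩ : (X 1 : PS K) ^ B ∣ h - h₁ := by
    rw [X_pow_dvd_iff]
    intro d hd
    rw [map_sub, hc]
    split_ifs with h0
    · simp
    · rw [sub_zero]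
      refine hh d ?_
      simp only [weight_eq, Matrix.cons_val_zero, Matrix.cons_val_one]
      rw [mul_comm (d 0), mul_comm (d 1)]
      have h1 := Nat.mul_lt_mul_of_pos_left (not_le.1 h0) hn
      have h2 := Nat.mul_lt_mul_of_pos_left hd hm
      omega
  exact Ideal.mem_span_pair.2 ⟨a, b, by linear_combination -ha - hb⟩

lemma X_pow_mem_weightedIdeal (w : Fin 2 → ℕ) (i : Fin 2) (A : ℕ) :
    (X i : PS K) ^ A ∈ weightedIdeal w (A * w i) := by
  rw [mem_weightedIdeal, X_pow_eq, weightedOrder_monomial_of_ne_zero _ one_ne_zero,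
    Finsupp.weight_single, smul_eq_mul]

/-- Nakayama's lemma for the filtration by weighted order. -/
lemma exists_weightedIdeal_le {n m k₀ : ℕ} (hn : 0 < n) (hm : 0 < m) {I : Ideal (PS K)}
    (h : ∀ k ≥ k₀, weightedIdeal ![n, m] k₀ ≤ I ⊔ weightedIdeal ![n, m] k) :
    ∃ k ≥ k₀, weightedIdeal ![n, m] k ≤ I := by
  set J : Ideal (PS K) := Ideal.span {(X 0 : PS K) ^ k₀, (X 1 : PS K) ^ k₀} with hJ
  have hJle : J ≤ weightedIdeal ![n, m] k₀ := by
    rw [hJ, Ideal.span_le]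
    rintro _ (rfl | rfl)
    · exact weightedIdeal_anti _ (by simpa using Nat.le_mul_of_pos_right k₀ hn)
        (X_pow_mem_weightedIdeal ![n, m] 0 k₀)
    · exact weightedIdeal_anti _ (by simpa using Nat.le_mul_of_pos_right k₀ hm)
        (X_pow_mem_weightedIdeal ![n, m] 1 k₀)
  let M : Ideal (PS K) := IsLocalRing.maximalIdeal (PS K)
  have hXM : ∀ i, (X i : PS K) ∈ M := by
    intro i
    rw [IsLocalRing.mem_maximalIdeal, mem_nonunits_iff, MvPowerSeries.isUnit_iff_constantCoeff]
    simp
  obtain ⟨k, hk, hk₀⟩ : ∃ k, n * (k₀ + 1) + m * (k₀ + 1) ≤ k ∧ k₀ ≤ k :=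
    ⟨n * (k₀ + 1) + m * (k₀ + 1) + k₀, by omega, by omega⟩
  have hkM : (weightedIdeal ![n, m] k : Ideal (PS K)) ≤ M • J := by
    refine (weightedIdeal_le_span_pow hn hm hk).trans ?_
    rw [Ideal.span_le]
    rintro _ (rfl | rfl)
    · rw [pow_succ']
      exact Submodule.smul_mem_smul (hXM 0) (Ideal.subset_span (by simp))
    · rw [pow_succ']
      exact Submodule.smul_mem_smul (hXM 1) (Ideal.subset_span (by simp))
  refine ⟨k, hk₀, hkM.trans (Submodule.smul_le_right.trans ?_)⟩
  refine Submodule.le_of_le_smul_of_le_jacobson_bot (I := M) ⟨{_, _}, by push_cast; exact hJ.symm⟩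
    (IsLocalRing.maximalIdeal_le_jacobson _) ?_
  exact hJle.trans ((h k hk₀).trans (sup_le_sup_left hkM I))

lemma weightedOrder_eq_of_mem {w : Fin 2 → ℕ} {t : ℕ} {h : PS K} {p : ℕ × ℕ}
    (hh : h ∈ weightedIdeal w t) (hp : coef K h p ≠ 0) (hpt : p.1 * w 0 + p.2 * w 1 = t) :
    h.weightedOrder w = t := by
  refine le_antisymm ((weightedOrder_le w hp).trans ?_) hh
  simp [weight_eq, ← hpt]

lemma coef_component (w : Fin 2 → ℕ) (t : ℕ) (h : PS K) (p : ℕ × ℕ) :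
    coef K (weightedHomogeneousComponent w t h) p =
      if p.1 * w 0 + p.2 * w 1 = t then coef K h p else 0 := by
  rw [coef, coeff_weightedHomogeneousComponent]
  simp [weight_eq, coef]

lemma psEval_component_eq_zero_of_exact {n m e s : ℕ} {f g : PS K} (hn : 0 < n) (hm : 0 < m)
    (hf : f ∈ weightedIdeal ![n, m] (n * m)) (hg : g ∈ weightedIdeal ![n, m] e)
    (hs : n * m + e ≤ n * s) (hX : (X 0 : PS K) ^ s ∈ Ideal.span {f, g})
    (hexact : KoszulExact ![n, m] (n * m) e f g (n * s)) (v : K × K)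
    (hvf : psEval K (weightedHomogeneousComponent ![n, m] (n * m) f) v = 0)
    (hvg : psEval K (weightedHomogeneousComponent ![n, m] e g) v = 0) : v.1 = 0 := by
  have hw : ∀ i, ![n, m] i ≠ 0 := by intro i; fin_cases i <;> simp <;> omega
  obtain ⟨a, b, hab⟩ := Ideal.mem_span_pair.1 hX
  have hXs : (X 0 : PS K) ^ s ∈ weightedIdeal ![n, m] (n * s) := by
    simpa [mul_comm] using X_pow_mem_weightedIdeal (K := K) ![n, m] 0 s
  obtain ⟨c, ha, hb⟩ := hexact a b (by rwa [hab])
  have h1 := weightedHomogeneousComponent_mul_of_le_weightedOrder ha hf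
  have h2 := weightedHomogeneousComponent_mul_of_le_weightedOrder hb hg
  rw [Nat.sub_add_cancel (by omega)] at h1 h2
  have h3 : weightedHomogeneousComponent ![n, m] (n * s) ((X 0 : PS K) ^ s) = X 0 ^ s := by
    ext d
    rw [coeff_weightedHomogeneousComponent, X_pow_eq]
    split_ifs with hd
    · rfl
    · rw [coeff_monomial, if_neg]
      rintro rfl
      exact hd (by simp [Finsupp.weight_single, mul_comm])
  rw [← hab, show a * f + b * g = (a - c * g) * f + (b + c * f) * g by ring, map_add, h1, h2,
    show (a - c * g) * f + (b + c * f) * g = a * f + b * g by ring, hab] at h3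
  obtain ⟨P, hP⟩ := exists_polynomial_component hw (n * s - n * m) (a - c * g)
  obtain ⟨Q, hQ⟩ := exists_polynomial_component hw (n * s - e) (b + c * f)
  obtain ⟨F, hF⟩ := exists_polynomial_component hw (n * m) f
  obtain ⟨G, hG⟩ := exists_polynomial_component hw e g
  rw [← hF, psEval_coe] at hvf
  rw [← hG, psEval_coe] at hvg
  rw [← hP, ← hQ, ← hF, ← hG] at h3
  have h4 : P * F + Q * G = MvPolynomial.X 0 ^ s := by
    apply MvPolynomial.coe_injective
    push_cast
    exact h3
  have h5 := congrArg (MvPolynomial.eval ![v.1, v.2]) h4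
  simp only [map_add, map_mul, hvf, hvg, mul_zero, add_zero, map_pow, MvPolynomial.eval_X,
    Matrix.cons_val_zero] at h5
  by_contra h0
  exact pow_ne_zero s h0 h5.symm

lemma psEval_component_zero_fst {n m : ℕ} {f : PS K} (hn : 0 < n) (hm : 0 < m)
    (hfy : coef K f (0, n) ≠ 0) (y : K)
    (hy : psEval K (weightedHomogeneousComponent ![n, m] (n * m) f) (0, y) = 0) : y = 0 := by
  rw [psEval, finsum_eq_single _ (0, n)] at hy
  · rw [coef_component, if_pos (by simp)] at hy
    simpa [hfy, hn.ne'] using hy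
  · rintro ⟨a, b⟩ hab
    rcases Nat.eq_zero_or_pos a with rfl | ha
    · rw [coef_component, if_neg]
      · simp
      · simp only [ne_eq, Prod.mk.injEq, true_and] at hab
        simp [mul_comm n m, mul_comm b m, hm.ne', hab]
    · simp [ha.ne']

lemma psEval_component_zero_snd {n m : ℕ} {f : PS K} (hn : 0 < n) (hm : 0 < m)
    (hfx : coef K f (m, 0) ≠ 0) (x : K)
    (hx : psEval K (weightedHomogeneousComponent ![n, m] (n * m) f) (x, 0) = 0) : x = 0 := by
  rw [psEval, finsum_eq_single _ (m, 0)] at hx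
  · rw [coef_component, if_pos (by simp [mul_comm])] at hx
    simpa [hfx, hm.ne'] using hx
  · rintro ⟨a, b⟩ hab
    rcases Nat.eq_zero_or_pos b with rfl | hb
    · rw [coef_component, if_neg]
      · simp
      · simp only [ne_eq, Prod.mk.injEq, and_true] at hab
        simp [mul_comm a n, hn.ne', hab]
    · simp [hb.ne']

/-- Intersection multiplicity of `f` and `g` in terms of their initial forms for a common weight,
when the initial form of `f` is convenient. -/
theorem iMultC_ge_of_weightedIdeal [IsAlgClosed K] {n m e : ℕ} {f g : PS K}
    (hn : 0 < n) (hm : 0 < m)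
    (hf : f ∈ weightedIdeal ![n, m] (n * m)) (hfy : coef K f (0, n) ≠ 0)
    (hg : g ∈ weightedIdeal ![n, m] e) (he : m ∣ e ∨ n ∣ e) :
    (e : Cardinal) ≤ iMultC K f g ∧ (iMultC K f g = (e : Cardinal) ↔
      ∀ v : K × K, psEval K (weightedHomogeneousComponent ![n, m] (n * m) f) v = 0 →
        psEval K (weightedHomogeneousComponent ![n, m] e g) v = 0 → v = (0, 0)) := by
  have hw : ∀ i, ![n, m] i ≠ 0 := by intro i; fin_cases i <;> simp <;> omega
  have hford : f.weightedOrder ![n, m] = (n * m : ℕ) :=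
    weightedOrder_eq_of_mem hf hfy (by simp)
  set I : Ideal (PS K) := Ideal.span {f, g} with hI
  have hfin : ∀ k, Module.Finite K (PS K ⧸ (I ⊔ weightedIdeal ![n, m] k)) := fun k => by
    have := finite_quotient_weightedIdeal (K := K) hn hm k
    exact finite_quotient_of_le le_sup_right
  have hdim := fun k (hk : n * m + e ≤ k) => finrank_quotient_sup hn hm hford hg he hk
  have hlow : (e : Cardinal) ≤ iMultC K f g := by
    refine le_trans ?_ (rank_quotient_le_of_le (le_sup_left (a := I)
      (b := weightedIdeal ![n, m] (n * m + e))))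
    rw [← Module.finrank_eq_rank]
    exact_mod_cast (hdim _ le_rfl).1
  refine ⟨hlow, fun heq => ?_, fun hz => ?_⟩
  · have hIfin : Module.Finite K (PS K ⧸ I) := by
      rw [← Module.rank_lt_aleph0_iff, show Module.rank K (PS K ⧸ I) = e from heq]
      exact Cardinal.natCast_lt_aleph0
    have hIdim : Module.finrank K (PS K ⧸ I) = e := Module.finrank_eq_of_rank_eq heq
    have hdim' : ∀ k, n * m + e ≤ k →
        Module.finrank K (PS K ⧸ (I ⊔ weightedIdeal ![n, m] k)) = e := by
      intro k hk
      refine le_antisymm ?_ (hdim k hk).1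
      have h := rank_quotient_le_of_le (le_sup_left (a := I) (b := weightedIdeal ![n, m] k))
      rw [← Module.finrank_eq_rank, ← Module.finrank_eq_rank, hIdim] at h
      exact_mod_cast h
    have hs : n * m + e ≤ n * (n * m + e) := Nat.le_mul_of_pos_left _ hn
    have hle : I ⊔ weightedIdeal ![n, m] (n * (n * m + e)) ≤ I :=
      le_of_finrank_quotient_eq le_sup_left (by rw [hIdim, hdim' _ hs])
    have hX : (X 0 : PS K) ^ (n * m + e) ∈ I := by
      refine (le_sup_right.trans hle) ?_
      simpa [mul_comm n] using X_pow_mem_weightedIdeal (K := K) ![n, m] 0 (n * m + e)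
    rintro ⟨x, y⟩ hvf hvg
    obtain rfl : x = 0 := psEval_component_eq_zero_of_exact hn hm hf hg hs hX
      ((hdim _ hs).2.1 (hdim' _ hs)) _ hvf hvg
    rw [psEval_component_zero_fst hn hm hfy y hvf]
  · obtain ⟨F, hF⟩ := exists_polynomial_component hw (n * m) f
    obtain ⟨G, hG⟩ := exists_polynomial_component hw e g
    have hFy : coef K (weightedHomogeneousComponent ![n, m] (n * m) f) (0, n) ≠ 0 := by
      rw [coef_component, if_pos (by simp)]
      exact hfy
    have hFord : (weightedHomogeneousComponent ![n, m] (n * m) f).weightedOrder ![n, m] =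
        (n * m : ℕ) :=
      weightedOrder_eq_of_mem (component_homogeneous_mem _ _ _) hFy (by simp)
    have hexact := koszulExact_of_syzygy hf hg hFord (by
      rw [← hF, ← hG] at hz ⊢
      rw [← hF] at hFy
      exact syzygy_of_no_common_zero hFy hz)
    have hdim' := fun k hk => (hdim k hk).2.2 (hexact k)
    obtain ⟨k, hk, hkI⟩ := exists_weightedIdeal_le (k₀ := n * m + e) hn hm (I := I) (by
      intro k hk
      refine le_sup_right.trans (le_of_finrank_quotient_eq
        (sup_le_sup_left (weightedIdeal_anti _ hk) I) ?_)
      rw [hdim' k hk, hdim' _ le_rfl])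
    have h := hdim' k hk
    rw [sup_eq_left.2 hkI] at h
    have hIfin := hfin k
    rw [sup_eq_left.2 hkI] at hIfin
    rw [iMultC, ← Module.finrank_eq_rank, h]

end WeightedMultiplicity

section NewtonEdge

open MvPowerSeries

/-- Among points strictly to the left of and above `(a, b)`, some point is joined to `(a, b)`
by a segment of least steepness, and it may be taken leftmost. -/
lemma exists_min_slope {C : Set (ℕ × ℕ)} (hC : C.Nonempty) (a b : ℕ)
    (h : ∀ p ∈ C, p.1 < a ∧ b < p.2) :
    ∃ p ∈ C, ∀ q ∈ C, (p.2 - b) * (a - q.1) ≤ (q.2 - b) * (a - p.1) ∧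
      ((p.2 - b) * (a - q.1) = (q.2 - b) * (a - p.1) → p.1 ≤ q.1) := by
  let key : ℕ × ℕ → ℕ := fun p => (p.2 - b) * (a.factorial / (a - p.1))
  obtain ⟨p, hp, hmin⟩ := (measure fun p => key p * a + p.1).wf.has_min C hC
  refine ⟨p, hp, fun q hq => ?_⟩
  have hkey : ∀ r ∈ C, key r * (a - r.1) = (r.2 - b) * a.factorial := by
    intro r hr
    have hr1 := (h r hr).1
    rw [mul_assoc, Nat.div_mul_cancel (Nat.dvd_factorial (by omega) (by omega))]
  have hle : key p * a + p.1 ≤ key q * a + q.1 := not_lt.1 (hmin q hq)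
  have hpa := (h p hp).1
  have hqa := (h q hq).1
  have hkp := hkey p hp
  have hkq := hkey q hq
  have hpos : 0 < a.factorial := a.factorial_pos
  have hkle : key p ≤ key q := by
    by_contra hcon
    have : (key q + 1) * a ≤ key p * a := Nat.mul_le_mul_right a (by omega)
    rw [add_mul] at this
    omega
  have hcross : ∀ r s : ℕ × ℕ, key r * (a - r.1) = (r.2 - b) * a.factorial →
      (r.2 - b) * (a - s.1) * a.factorial = key r * ((a - r.1) * (a - s.1)) := by
    intro r s hr
    rw [← mul_assoc, hr]
    ring
  have hp' := hcross p q hkp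
  have hq' := hcross q p hkq
  rw [mul_comm (a - q.1) (a - p.1)] at hq'
  constructor
  · refine le_of_mul_le_mul_right ?_ hpos
    rw [hp', hq']
    exact Nat.mul_le_mul_right _ hkle
  · intro heq
    rw [heq, hq'] at hp'
    have hprod : 0 < (a - p.1) * (a - q.1) := Nat.mul_pos (by omega) (by omega)
    have := Nat.eq_of_mul_eq_mul_right hprod hp'
    rw [this] at hle
    omega

/-- If a linear form with positive coefficients is minimal at `A` on `s`, strictly so with respect
to the points left of `A`, then `A` is the right end of a further edge of `s`. -/
lemma exists_edge_left {s : Set (ℕ × ℕ)} {A w : ℕ × ℕ} (hw2 : 0 < w.2)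
    (hmin : ∀ q ∈ s, w.1 * A.1 + w.2 * A.2 ≤ w.1 * q.1 + w.2 * q.2)
    (hstrict : ∀ q ∈ s, q.1 < A.1 → w.1 * A.1 + w.2 * A.2 < w.1 * q.1 + w.2 * q.2)
    (hne : ∃ q ∈ s, q.1 < A.1) :
    ∃ p ∈ s, ∃ u v : ℕ, 0 < u ∧ 0 < v ∧ p.1 < A.1 ∧ A.2 < p.2 ∧
      u * A.1 + v * A.2 = u * p.1 + v * p.2 ∧
      ∀ q ∈ s, u * p.1 + v * p.2 ≤ u * q.1 + v * q.2 ∧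
        (u * q.1 + v * q.2 = u * p.1 + v * p.2 → p.1 ≤ q.1 ∧ q.1 ≤ A.1) := by
  have hC : ∀ p ∈ {p | p ∈ s ∧ p.1 < A.1}, p.1 < A.1 ∧ A.2 < p.2 := by
    rintro p ⟨hp, hlt⟩
    refine ⟨hlt, ?_⟩
    have := hstrict p hp hlt
    by_contra hcon
    nlinarith
  obtain ⟨p, ⟨hp, hpa⟩, hslope⟩ := exists_min_slope hne A.1 A.2 hC
  have hpb := (hC p ⟨hp, hpa⟩).2
  have hps := hstrict p hp hpa
  have hline : (p.2 - A.2) * A.1 + (A.1 - p.1) * A.2 =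
      (p.2 - A.2) * p.1 + (A.1 - p.1) * p.2 := by
    zify [hpb.le, hpa.le]
    ring
  refine ⟨p, hp, p.2 - A.2, A.1 - p.1, by omega, by omega, hpa, hpb, hline, fun q hq => ?_⟩
  rw [← hline]
  rcases lt_or_ge q.1 A.1 with hqa | hqa
  · obtain ⟨h1, h2⟩ := hslope q ⟨hq, hqa⟩
    have hqb := (hC q ⟨hq, hqa⟩).2
    refine ⟨?_, fun heq => ⟨h2 ?_, hqa.le⟩⟩
    · zify [hpb.le, hpa.le, hqb.le, hqa.le] at h1 ⊢
      linarith
    · zify [hpb.le, hpa.le, hqb.le, hqa.le] at heq ⊢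
      linarith
  · have h1 := hmin q hq
    have hwuv : w.1 * (A.1 - p.1) < w.2 * (p.2 - A.2) := by
      zify [hpb.le, hpa.le] at hps ⊢
      linarith
    have hpa' : p.1 < q.1 := by omega
    zify [hpb.le, hpa.le] at h1 hwuv hqa hpa hpb hw2 ⊢
    have h3 := mul_le_mul_of_nonneg_left h1 (sub_nonneg.2 hpa.le)
    refine ⟨?_, fun heq => ⟨by exact_mod_cast hpa'.le, ?_⟩⟩
    · have h4 := mul_le_mul_of_nonneg_right hwuv.le (sub_nonneg.2 hqa)
      refine le_of_mul_le_mul_left ?_ hw2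
      linarith
    · by_contra hcon
      have h4 := mul_lt_mul_of_pos_right hwuv (sub_pos.2 (not_le.1 hcon))
      have h5 := congrArg (fun z : ℤ => w.2 * z) heq
      linarith

variable {K}

lemma NEdge.A_fst_eq_zero {f : PS K} {S : NEdge} (hf : Convenient K f)
    (hS : newtonPolygon K f = {S}) : S.A.1 = 0 := by
  by_contra ha
  obtain ⟨hA, hB, w, hw1, hw2, hAB, hmin, hex⟩ : S ∈ newtonPolygon K f := by rw [hS]; rfl
  obtain ⟨b₀, hb₀⟩ := hf.2
  obtain ⟨p, hp, u, v, hu, hv, hpa, hpb, hline, key⟩ := exists_edge_left hw2 hmin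
    (fun p hp hlt => lt_of_le_of_ne (hmin p hp) fun heq =>
      absurd (hex p hp heq.symm).1 (by omega))
    ⟨(0, b₀), hb₀, Nat.pos_of_ne_zero ha⟩
  have hmem : (⟨p, S.A, hpa, hpb⟩ : NEdge) ∈ newtonPolygon K f :=
    ⟨hp, hA, (u, v), hu, hv, hline, fun q hq => (key q hq).1, fun q hq => (key q hq).2⟩
  rw [hS, Set.mem_singleton_iff] at hmem
  have hBA : S.A = S.B := congrArg NEdge.B hmem
  exact absurd S.hx (by rw [← hBA]; exact lt_irrefl _)

lemma NEdge.B_snd_eq_zero {f : PS K} {S : NEdge} (hf : Convenient K f)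
    (hS : newtonPolygon K f = {S}) : S.B.2 = 0 := by
  by_contra hb
  obtain ⟨hA, hB, w, hw1, hw2, hAB, hmin, hex⟩ : S ∈ newtonPolygon K f := by rw [hS]; rfl
  obtain ⟨a₀, ha₀⟩ := hf.1
  obtain ⟨p, hp, u, v, hu, hv, hpb, hpa, hline, key⟩ :=
    exists_edge_left (s := Prod.swap ⁻¹' supp K f) (A := S.B.swap) (w := w.swap) hw1
    (fun q hq => by
      have := hmin _ hq
      simp only [Prod.fst_swap, Prod.snd_swap] at this ⊢
      omega)
    (fun q hq hlt => by
      have h1 := hmin _ hq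
      have h2 := hex _ hq
      simp only [Prod.fst_swap, Prod.snd_swap] at h1 h2 hlt ⊢
      refine lt_of_le_of_ne (by omega) fun heq => ?_
      have h3 := (h2 (by omega)).2
      have h4 := Nat.mul_le_mul_left w.1 h3
      have h5 := Nat.mul_lt_mul_of_pos_left hlt hw2
      omega)
    ⟨(0, a₀), ha₀, Nat.pos_of_ne_zero hb⟩
  simp only [Prod.fst_swap, Prod.snd_swap] at hpa hpb hline
  have hmem : (⟨S.B, p.swap, hpa, hpb⟩ : NEdge) ∈ newtonPolygon K f := by
    refine ⟨hB, hp, (v, u), hv, hu, ?_, fun q hq => ?_, fun q hq heq => ?_⟩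
    · simp only [Prod.fst_swap, Prod.snd_swap]
      omega
    · have := (key q.swap (by simpa using hq)).1
      simp only [Prod.fst_swap, Prod.snd_swap] at this ⊢
      omega
    · have := (key q.swap (by simpa using hq)).2
      simp only [Prod.fst_swap, Prod.snd_swap] at this heq ⊢
      obtain ⟨h1, h2⟩ := this (by omega)
      have h3 := Nat.mul_le_mul_left u h1
      have h4 := Nat.mul_le_mul_left u h2
      exact ⟨le_of_mul_le_mul_left (a := v) (by omega) hv,
        le_of_mul_le_mul_left (a := v) (by omega) hv⟩
  rw [hS, Set.mem_singleton_iff] at hmem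
  have hAB' : S.B = S.A := congrArg NEdge.A hmem
  exact absurd S.hx (by rw [hAB']; exact lt_irrefl _)

/-- The single edge of a convenient series joins `(0, |S|₂)` to `(|S|₁, 0)`, and the support lies
on or above it. -/
lemma single_edge_spec {f : PS K} {S : NEdge} (hf : Convenient K f)
    (hS : newtonPolygon K f = {S}) :
    S.A = (0, S.len2) ∧ S.B = (S.len1, 0) ∧ 0 < S.len1 ∧ 0 < S.len2 ∧
      coef K f (0, S.len2) ≠ 0 ∧ coef K f (S.len1, 0) ≠ 0 ∧
      ∀ p, coef K f p ≠ 0 → S.len2 * S.len1 ≤ S.len2 * p.1 + S.len1 * p.2 := by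
  have hA := NEdge.A_fst_eq_zero hf hS
  have hB := NEdge.B_snd_eq_zero hf hS
  have hA' : S.A = (0, S.len2) := Prod.ext hA (by simp [NEdge.len2, hB])
  have hB' : S.B = (S.len1, 0) := Prod.ext (by simp [NEdge.len1, hA]) hB
  obtain ⟨hAs, hBs, w, hw1, hw2, hAB, hmin, -⟩ : S ∈ newtonPolygon K f := by rw [hS]; rfl
  refine ⟨hA', hB', Nat.sub_pos_of_lt S.hx, Nat.sub_pos_of_lt S.hy, hA' ▸ hAs, hB' ▸ hBs, ?_⟩
  intro p hp
  have h := hmin p hp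
  simp only [hA', hB', mul_zero, zero_add, add_zero] at h hAB
  refine le_of_mul_le_mul_left ?_ hw2
  have h1 := Nat.mul_le_mul_right S.len1 h
  calc w.2 * (S.len2 * S.len1) = w.2 * S.len2 * S.len1 := by ring
    _ ≤ (w.1 * p.1 + w.2 * p.2) * S.len1 := h1
    _ = w.1 * S.len1 * p.1 + w.2 * (S.len1 * p.2) := by ring
    _ = w.2 * (S.len2 * p.1 + S.len1 * p.2) := by rw [hAB]; ring

lemma mem_weightedIdeal_of_coef {n m t : ℕ} {f : PS K}
    (h : ∀ p, coef K f p ≠ 0 → t ≤ n * p.1 + m * p.2) : f ∈ weightedIdeal ![n, m] t := by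
  rw [mem_weightedIdeal_iff_coeff]
  intro d hd
  rw [coeff_eq_coef]
  by_contra hne
  have := h _ hne
  dsimp only at this
  simp only [weight_eq, Matrix.cons_val_zero, Matrix.cons_val_one, mul_comm (d 0),
    mul_comm (d 1)] at hd
  omega

lemma initialForm_eq_component {f : PS K} {S : NEdge} (hA : S.A = (0, S.len2))
    (hB : S.B = (S.len1, 0)) (h1 : 0 < S.len1) (h2 : 0 < S.len2) :
    initialForm K f S =
      weightedHomogeneousComponent ![S.len2, S.len1] (S.len2 * S.len1) f := by
  ext d
  rw [coeff_weightedHomogeneousComponent, coeff_eq_coef f]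
  change (if S.mem (d 0, d 1) then _ else _) = _
  refine if_congr ?_ rfl rfl
  simp only [NEdge.mem, weight_eq, hA, hB, Matrix.cons_val_zero, Matrix.cons_val_one, zero_le,
    true_and, Nat.sub_zero, Nat.sub_mul]
  constructor
  · rintro ⟨-, h4, h5⟩
    have := Nat.mul_le_mul_right S.len1 h4
    omega
  · intro h
    refine ⟨le_of_mul_le_mul_right (a := S.len2) ?_ h2,
      le_of_mul_le_mul_right (a := S.len1) ?_ h1, by omega⟩
    · rw [mul_comm S.len1]; omega
    · omega

lemma psEval_eq_single {h : PS K} (p : ℕ × ℕ) (hp : ∀ q, q ≠ p → coef K h q = 0) (v : K × K) :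
    psEval K h v = coef K h p * v.1 ^ p.1 * v.2 ^ p.2 :=
  finsum_eq_single _ p fun q hq => by rw [hp q hq, zero_mul, zero_mul]

end NewtonEdge

theorem iMult_ge_bracket (K : Type u) [Field K] [IsAlgClosed K]
    (f g : PS K) (hf : Convenient K f) (hg : Convenient K g)
    (S T : NEdge) (hS : newtonPolygon K f = {S}) (hT : newtonPolygon K g = {T}) :
    (bracket S T : Cardinal) ≤ iMultC K f g ∧
      (iMultC K f g = (bracket S T : Cardinal) ↔
        (S.len1 * T.len2 ≠ S.len2 * T.len1 ∨
          ∀ v : K × K,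
            psEval K (initialForm K f S) v = 0 → psEval K (initialForm K g T) v = 0 →
              v = (0, 0))) := by
  obtain ⟨hSA, hSB, hm, hn, hfy, hfx, hfmin⟩ := single_edge_spec hf hS
  obtain ⟨hTA, hTB, hm', hn', hgy, hgx, hgmin⟩ := single_edge_spec hg hT
  rw [initialForm_eq_component hSA hSB hm hn, initialForm_eq_component hTA hTB hm' hn', bracket]
  generalize S.len1 = m at *
  generalize S.len2 = n at *
  generalize T.len1 = m' at *
  generalize T.len2 = n' at *
  have hfw := mem_weightedIdeal_of_coef hfmin
  have hcoefG : ∀ e p, coef K (MvPowerSeries.weightedHomogeneousComponent ![n, m] e g) p ≠ 0 →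
      n * p.1 + m * p.2 = e ∧ n' * m' ≤ n' * p.1 + m' * p.2 := by
    intro e p hp
    rw [coef_component] at hp
    obtain ⟨h1, h2⟩ := ite_ne_right_iff.1 hp
    exact ⟨by simpa [mul_comm] using h1, hgmin p h2⟩
  rcases lt_trichotomy (m * n') (n * m') with hlt | heq | hlt
  · rw [min_eq_left hlt.le]
    obtain ⟨h1, h2⟩ := iMultC_ge_of_weightedIdeal (e := m * n') hn hm hfw hfy
      (mem_weightedIdeal_of_coef fun p hp => by
        have := hgmin p hp
        refine le_of_mul_le_mul_right (a := m') ?_ hm'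
        nlinarith) (Or.inl (dvd_mul_right m n'))
    refine ⟨h1, h2.trans ⟨fun _ => Or.inl hlt.ne, fun _ => ?_⟩⟩
    rintro ⟨x, y⟩ hvf hvg
    rw [psEval_eq_single (0, n')] at hvg
    · rw [coef_component, if_pos (by simp [mul_comm])] at hvg
      obtain rfl : y = 0 := by simpa [hgy, hn'.ne'] using hvg
      rw [psEval_component_zero_snd hn hm hfx x hvf]
    · intro q hq
      by_contra hne
      obtain ⟨h3, h4⟩ := hcoefG _ q hne
      have h5 : q.1 = 0 := by
        by_contra hq0
        have h6 := Nat.mul_lt_mul_of_pos_right hlt (Nat.pos_of_ne_zero hq0)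
        nlinarith
      rw [h5, mul_zero, zero_add] at h3
      exact hq (Prod.ext h5 (Nat.eq_of_mul_eq_mul_left hm h3))
  · have hcomp : MvPowerSeries.weightedHomogeneousComponent ![n, m] (m * n') g =
        MvPowerSeries.weightedHomogeneousComponent ![n', m'] (n' * m') g := by
      ext d
      simp only [MvPowerSeries.coeff_weightedHomogeneousComponent, weight_eq,
        Matrix.cons_val_zero, Matrix.cons_val_one]
      refine if_congr ⟨fun h => ?_, fun h => ?_⟩ rfl rfl
      · refine Nat.eq_of_mul_eq_mul_left hm ?_
        linear_combination d 0 * heq + m' * h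
      · refine Nat.eq_of_mul_eq_mul_left hm' ?_
        linear_combination m * h - d 0 * heq
    obtain ⟨h1, h2⟩ := iMultC_ge_of_weightedIdeal (e := m * n') hn hm hfw hfy
      (mem_weightedIdeal_of_coef fun p hp => by
        have := hgmin p hp
        refine le_of_mul_le_mul_right (a := m') ?_ hm'
        nlinarith) (Or.inl (dvd_mul_right m n'))
    rw [min_eq_left heq.le, ← hcomp]
    exact ⟨h1, h2.trans (or_iff_right (not_not_intro heq)).symm⟩
  · rw [min_eq_right hlt.le]
    obtain ⟨h1, h2⟩ := iMultC_ge_of_weightedIdeal (e := n * m') hn hm hfw hfy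
      (mem_weightedIdeal_of_coef fun p hp => by
        have := hgmin p hp
        refine le_of_mul_le_mul_right (a := n') ?_ hn'
        nlinarith) (Or.inr (dvd_mul_right n m'))
    refine ⟨h1, h2.trans ⟨fun _ => Or.inl hlt.ne', fun _ => ?_⟩⟩
    rintro ⟨x, y⟩ hvf hvg
    rw [psEval_eq_single (m', 0)] at hvg
    · rw [coef_component, if_pos (by simp [mul_comm])] at hvg
      obtain rfl : x = 0 := by simpa [hgx, hm'.ne'] using hvg
      rw [psEval_component_zero_fst hn hm hfy y hvf]
    · intro q hq
      by_contra hne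
      obtain ⟨h3, h4⟩ := hcoefG _ q hne
      have h5 : q.2 = 0 := by
        by_contra hq0
        have h6 := Nat.mul_lt_mul_of_pos_right hlt (Nat.pos_of_ne_zero hq0)
        nlinarith
      rw [h5, mul_zero, add_zero] at h3
      exact hq (Prod.ext (Nat.eq_of_mul_eq_mul_left hn h3) h5)

end PlaneCurveNote
end
end

section
/- Let K be an algebraically closed field and let f ∈ K[[x,y]] be irreducible and convenient of bidegree (m,n) = (ord f(x,0), ord f(0,y)), with d = gcd(m,n). Then μ̄(f) ≥ (m−1)(n−1) + d − 1. -/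
/-!
Common definitions for formalizing "A note on the plane curve singularities in
positive characteristic" by E. García Barroso and A. Płoski.

We work with the ring `K[[x,y]] := MvPowerSeries (Fin 2) K`, where `x` is the
variable of index `0` and `y` the variable of index `1`.
-/

open scoped Classical

noncomputable section

universe u

namespace PlaneCurveNote

variable (K : Type u) [Field K]

theorem gcd_le_two_mul_sum_div (m n : ℕ) (hm : 0 < m) (hn : 0 < n) :
    (m - 1) * (n - 1) + (Nat.gcd m n - 1) ≤ 2 * ∑ j ∈ Finset.range m, j * n / m := by
  have h0 : ∑ j ∈ Finset.range m, j * n / m = ∑ j ∈ Finset.Ico 1 m, j * n / m := by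
    rw [Finset.range_eq_Ico, Finset.sum_eq_sum_Ico_succ_bot hm]; simp
  have hrefl : ∑ j ∈ Finset.Ico 1 m, (m - j) * n / m = ∑ j ∈ Finset.Ico 1 m, j * n / m := by
    refine Finset.sum_bij' (fun j _ => m - j) (fun j _ => m - j) ?_ ?_ ?_ ?_ ?_ <;>
      simp only [Finset.mem_Ico] <;> intros <;> first | omega | trivial
  have hterm : ∀ j ∈ Finset.Ico 1 m,
      (n - 1) + (if m ∣ j * n then 1 else 0) ≤ j * n / m + (m - j) * n / m := by
    intro j hj
    rw [Finset.mem_Ico] at hj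
    have hs : j * n + (m - j) * n = m * n := by rw [← add_mul]; congr 1; omega
    split_ifs with hdvd
    · have h2 : m ∣ (m - j) * n := (Nat.dvd_add_right hdvd).1 (hs ▸ dvd_mul_right m n)
      obtain ⟨a, ha⟩ := hdvd
      obtain ⟨b, hb⟩ := h2
      rw [ha, hb, Nat.mul_div_cancel_left _ hm, Nat.mul_div_cancel_left _ hm]
      rw [ha, hb, ← mul_add] at hs
      have := Nat.eq_of_mul_eq_mul_left hm hs
      omega
    · have h1 := Nat.div_add_mod (j * n) m
      have h2 := Nat.div_add_mod ((m - j) * n) m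
      have h3 := Nat.mod_lt (j * n) hm
      have h4 := Nat.mod_lt ((m - j) * n) hm
      have : m * n < m * (j * n / m + (m - j) * n / m + 2) := by
        rw [mul_add, mul_add]; omega
      have := Nat.lt_of_mul_lt_mul_left this
      omega
  have hcard : Nat.gcd m n - 1 ≤ ∑ j ∈ Finset.Ico 1 m, (if m ∣ j * n then 1 else 0) := by
    rw [← Finset.sum_filter, ← Finset.card_eq_sum_ones]
    obtain ⟨a, ha⟩ := Nat.gcd_dvd_left m n
    obtain ⟨b, hb⟩ := Nat.gcd_dvd_right m n
    have hd : 0 < Nat.gcd m n := Nat.gcd_pos_of_pos_left _ hm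
    have ha0 : 0 < a := Nat.pos_of_ne_zero fun h => by simp [h] at ha; omega
    rw [← Nat.card_Ico 1]
    refine Finset.card_le_card_of_injOn (fun k => k * a) (fun k hk => ?_) (fun k _ l _ h => ?_)
    · simp only [Finset.coe_Ico, Set.mem_Ico] at hk
      simp only [Finset.coe_filter, Finset.mem_Ico, Set.mem_ofPred_eq]
      refine ⟨⟨Nat.mul_pos hk.1 ha0, ?_⟩, ?_⟩
      · conv_rhs => rw [ha]
        exact Nat.mul_lt_mul_of_pos_right hk.2 ha0
      · refine ⟨k * b, ?_⟩
        calc k * a * n = k * a * (Nat.gcd m n * b) := by rw [← hb]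
          _ = (Nat.gcd m n * a) * (k * b) := by ring
          _ = m * (k * b) := by rw [← ha]
    · exact Nat.eq_of_mul_eq_mul_right ha0 h
  have hsum := Finset.sum_le_sum hterm
  rw [Finset.sum_add_distrib, Finset.sum_add_distrib, hrefl, Finset.sum_const, Nat.card_Ico,
    smul_eq_mul] at hsum
  rw [h0]
  omega

section LaurentNorm
open PowerSeries LaurentSeries Valued
variable (K : Type u) [Field K]

/-- The `X`-adic valuation of `K((X))` has rank one. -/
local instance laurentRankOne :
    (Valued.v : Valuation K⸨X⸩ (WithZero (Multiplicative ℤ))).RankOne := by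
  have : (Valued.v : Valuation K⸨X⸩ (WithZero (Multiplicative ℤ))).IsNontrivial :=
    ⟨⟨((X : K⟦X⟧) : K⸨X⸩), by
    have := LaurentSeries.valuation_X_pow K 1
    rw [pow_one] at this
    rw [this]
    exact ⟨by simp, by simp⟩⟩⟩
  refine (Valuation.nonempty_rankOne_iff_mulArchimedean.2 ?_).some
  infer_instance

variable {K}

theorem norm_le_one_iff_mem_range {z : K⸨X⸩} :
    ‖z‖ ≤ 1 ↔ ∃ a : K⟦X⟧, algebraMap K⟦X⟧ K⸨X⸩ a = z := by
  rw [Valued.toNormedField.norm_le_one_iff]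
  exact LaurentSeries.val_le_one_iff_eq_coe K z

theorem norm_X_pos : 0 < ‖algebraMap K⟦X⟧ K⸨X⸩ X‖ :=
  norm_pos_iff.2 ((map_ne_zero_iff _ (IsFractionRing.injective K⟦X⟧ K⸨X⸩)).2 X_ne_zero)

theorem norm_X_lt_one : ‖algebraMap K⟦X⟧ K⸨X⸩ X‖ < 1 := by
  rw [Valued.toNormedField.norm_lt_one_iff]
  have := LaurentSeries.valuation_X_pow K 1
  rw [pow_one] at this
  change Valued.v ((HahnSeries.ofPowerSeries ℤ K) X) < 1
  rw [this, ← WithZero.exp_zero, WithZero.exp_lt_exp]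
  norm_num

variable {L : Type u} [Field L] [Algebra K⸨X⸩ L] [FiniteDimensional K⸨X⸩ L] [Algebra K⟦X⟧ L]
  [IsScalarTower K⟦X⟧ K⸨X⸩ L]

theorem spectralNorm_le_one_iff_isIntegral (z : L) :
    spectralNorm K⸨X⸩ L z ≤ 1 ↔ IsIntegral K⟦X⟧ z := by
  have hz : IsIntegral K⸨X⸩ z := Algebra.IsIntegral.isIntegral z
  rw [spectralNorm, spectralValue_le_one_iff (minpoly.monic hz)]
  constructor
  · intro h
    have hl : minpoly K⸨X⸩ z ∈ Polynomial.lifts (algebraMap K⟦X⟧ K⸨X⸩) := by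
      rw [Polynomial.lifts_iff_coeff_lifts]
      exact fun i => norm_le_one_iff_mem_range.1 (h i)
    obtain ⟨q, hq, -, hqm⟩ := Polynomial.lifts_and_natDegree_eq_and_monic hl (minpoly.monic hz)
    refine ⟨q, hqm, ?_⟩
    rw [← Polynomial.aeval_def, ← Polynomial.aeval_map_algebraMap K⸨X⸩, hq, minpoly.aeval]
  · intro h i
    rw [minpoly.isIntegrallyClosed_eq_field_fractions' K⸨X⸩ h, Polynomial.coeff_map]
    exact norm_le_one_iff_mem_range.2 ⟨_, rfl⟩

theorem isIntegral_pow_div (y : L) (c : K⟦X⟧) (n : ℕ)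
    (hc : (minpoly K⸨X⸩ y).coeff 0 = algebraMap K⟦X⟧ K⸨X⸩ c) (hn : X ^ n ∣ c) (i j : ℕ)
    (hij : i * (minpoly K⸨X⸩ y).natDegree ≤ j * n) :
    IsIntegral K⟦X⟧ (algebraMap K⸨X⸩ L (algebraMap K⟦X⟧ K⸨X⸩ X)⁻¹ ^ i * y ^ j) := by
  set t := ‖algebraMap K⟦X⟧ K⸨X⸩ X‖ with ht
  set m := (minpoly K⸨X⸩ y).natDegree with hm
  have hm0 : m ≠ 0 := (minpoly.natDegree_pos (Algebra.IsIntegral.isIntegral y)).ne'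
  have ht0 : 0 < t := norm_X_pos
  have ht1 : t ≤ 1 := norm_X_lt_one.le
  set s := spectralMulAlgNorm K⸨X⸩ L y with hs
  have hs0 : 0 ≤ s := apply_nonneg _ _
  have hsm : s ^ m ≤ t ^ n := by
    have h1 : s = ‖(minpoly K⸨X⸩ y).coeff 0‖ ^ (1 / (m : ℝ)) :=
      spectralNorm.spectralNorm_eq_norm_coeff_zero_rpow K⸨X⸩ L y
    rw [h1, ← Real.rpow_natCast, ← Real.rpow_mul (norm_nonneg _),
      one_div_mul_cancel (by exact_mod_cast hm0), Real.rpow_one, hc]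
    obtain ⟨b, rfl⟩ := hn
    rw [map_mul, map_pow, norm_mul, norm_pow]
    exact mul_le_of_le_one_right (by positivity) (norm_le_one_iff_mem_range.2 ⟨_, rfl⟩)
  rw [← spectralNorm_le_one_iff_isIntegral, ← spectralMulAlgNorm_def, map_mul, map_pow, map_pow,
    spectralMulAlgNorm_def, spectralNorm_extends, norm_inv, ← ht, ← hs, inv_pow,
    inv_mul_le_one₀ (by positivity)]
  refine le_of_pow_le_pow_left₀ hm0 (by positivity) ?_
  calc (s ^ j) ^ m = (s ^ m) ^ j := by rw [← pow_mul, ← pow_mul, mul_comm]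
    _ ≤ (t ^ n) ^ j := by gcongr
    _ = t ^ (j * n) := by rw [← pow_mul, mul_comm]
    _ ≤ t ^ (i * m) := pow_le_pow_of_le_one ht0.le ht1 hij
    _ = (t ^ i) ^ m := by rw [← pow_mul]

theorem exists_pow_mul_repr_mem_range {ι : Type} [Fintype ι] (b : Module.Basis ι K⸨X⸩ L) :
    ∃ N : ℕ, ∀ z : L, IsIntegral K⟦X⟧ z → ∀ k, ∃ a : K⟦X⟧,
      algebraMap K⟦X⟧ K⸨X⸩ X ^ N * b.repr z k = algebraMap K⟦X⟧ K⸨X⸩ a := by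
  let : NormedAddCommGroup L := spectralNorm.normedAddCommGroup K⸨X⸩ L
  let : NormedSpace K⸨X⸩ L := spectralNorm.normedSpace K⸨X⸩ L
  have hbound : ∀ k, ∃ N : ℕ, ∀ z : L, IsIntegral K⟦X⟧ z →
      ‖algebraMap K⟦X⟧ K⸨X⸩ X‖ ^ N * ‖b.repr z k‖ ≤ 1 := by
    intro k
    let φ : L →L[K⸨X⸩] K⸨X⸩ := LinearMap.toContinuousLinearMap (b.coord k)
    obtain ⟨N, hN⟩ := exists_pow_lt_of_lt_one (y := ‖algebraMap K⟦X⟧ K⸨X⸩ X‖)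
      (show 0 < (‖φ‖ + 1)⁻¹ by positivity) norm_X_lt_one
    refine ⟨N, fun z hz => ?_⟩
    have hz1 : ‖z‖ ≤ 1 := (spectralNorm_le_one_iff_isIntegral z).2 hz
    have h1 : ‖b.repr z k‖ ≤ ‖φ‖ :=
      (φ.le_opNorm z).trans (mul_le_of_le_one_right (by positivity) hz1)
    calc _ ≤ (‖φ‖ + 1)⁻¹ * (‖φ‖ + 1) := by gcongr; linarith
      _ = 1 := inv_mul_cancel₀ (by positivity)
  choose N hN using hbound
  refine ⟨∑ k, N k, fun z hz k => ?_⟩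
  have : ‖algebraMap K⟦X⟧ K⸨X⸩ X ^ (∑ k, N k) * b.repr z k‖ ≤ 1 := by
    rw [norm_mul, norm_pow]
    refine le_trans ?_ (hN k z hz)
    exact mul_le_mul_of_nonneg_right (pow_le_pow_of_le_one (norm_X_pos (K := K)).le
      norm_X_lt_one.le (Finset.single_le_sum (f := N) (fun _ _ => Nat.zero_le _)
      (Finset.mem_univ k))) (norm_nonneg _)
  obtain ⟨a, ha⟩ := norm_le_one_iff_mem_range.1 this
  exact ⟨a, ha.symm⟩

end LaurentNorm

section Codimension

/-- The dimension over `K` of the integral closure of `O` in `L` modulo (the image of) `O`. -/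
def normalizationCodim (K O L : Type*) [Field K] [CommRing O] [CommRing L] [Algebra K L]
    [Algebra O L] : ℕ :=
  letI N : Submodule K L := Submodule.span K (integralClosure O L : Set L)
  letI P : Submodule K L := Submodule.span K (Set.range (algebraMap O L))
  Module.finrank K (↥N ⧸ (P.comap N.subtype))

theorem normalizationCodim_congr {K O O' L L' : Type*} [Field K] [CommRing O] [CommRing O']
    [CommRing L] [CommRing L'] [Algebra K O] [Algebra K O'] [Algebra K L] [Algebra K L']
    [Algebra O L] [Algebra O' L'] [IsScalarTower K O L] [IsScalarTower K O' L']
    [IsFractionRing O L] [IsFractionRing O' L'] (e : O ≃ₐ[K] O') :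
    normalizationCodim K O L = normalizationCodim K O' L' := by
  let σ : L ≃+* L' := IsFractionRing.ringEquivOfRingEquiv e.toRingEquiv
  have hσ : ∀ o, σ (algebraMap O L o) = algebraMap O' L' (e o) := fun o =>
    IsFractionRing.ringEquivOfRingEquiv_algebraMap e.toRingEquiv o
  let τ : L ≃ₐ[K] L' := AlgEquiv.ofRingEquiv (f := σ) fun r => by
    rw [IsScalarTower.algebraMap_apply K O L, hσ, e.commutes,
      ← IsScalarTower.algebraMap_apply K O' L']
  have hτ : ∀ o, τ (algebraMap O L o) = algebraMap O' L' (e o) := hσ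
  have hP : τ '' Set.range (algebraMap O L) = Set.range (algebraMap O' L') := by
    ext z
    constructor
    · rintro ⟨_, ⟨o, rfl⟩, rfl⟩
      exact ⟨e o, (hτ o).symm⟩
    · rintro ⟨o, rfl⟩
      exact ⟨_, ⟨e.symm o, rfl⟩, by rw [hτ, e.apply_symm_apply]⟩
  have hN : τ '' (integralClosure O L : Set L) = (integralClosure O' L' : Set L') := by
    ext z
    constructor
    · rintro ⟨z, hz, rfl⟩
      exact IsIntegral.map_of_comp_eq (e : O →+* O') (τ : L →+* L')
        (RingHom.ext fun o => (hτ o).symm) hz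
    · intro hz
      refine ⟨τ.symm z, ?_, τ.apply_symm_apply z⟩
      refine IsIntegral.map_of_comp_eq (e.symm : O' →+* O) (τ.symm : L' →+* L)
        (RingHom.ext fun o => ?_) hz
      simp only [RingHom.comp_apply, RingHom.coe_coe]
      rw [AlgEquiv.eq_symm_apply, hτ, e.apply_symm_apply]
  unfold normalizationCodim
  set N := Submodule.span K (integralClosure O L : Set L)
  set P := Submodule.span K (Set.range (algebraMap O L))
  have hN' : N.map (τ.toLinearEquiv : L →ₗ[K] L') =
      Submodule.span K (integralClosure O' L' : Set L') := by
    rw [Submodule.map_span, ← hN]; rfl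
  have hP' : P.map (τ.toLinearEquiv : L →ₗ[K] L') =
      Submodule.span K (Set.range (algebraMap O' L')) := by
    rw [Submodule.map_span, ← hP]; rfl
  rw [← hN', ← hP']
  refine LinearEquiv.finrank_eq (Submodule.Quotient.equiv _ _
    (τ.toLinearEquiv.submoduleMap N) ?_)
  ext ⟨z, hz⟩
  obtain ⟨w, hw, rfl⟩ := hz
  constructor
  · rintro ⟨⟨w', hw'⟩, h1, h2⟩
    exact ⟨w', h1, congrArg Subtype.val h2⟩
  · rintro ⟨w', h1, h2⟩
    obtain rfl : w' = w := τ.toLinearEquiv.injective h2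
    exact ⟨⟨w', hw⟩, h1, rfl⟩

end Codimension

section Counting
open PowerSeries LaurentSeries
variable {K : Type u} [Field K]

theorem mem_range_algebraMap_iff_coeff {z : K⸨X⸩} :
    (∃ a : K⟦X⟧, z = algebraMap K⟦X⟧ K⸨X⸩ a) ↔ ∀ d : ℤ, d < 0 → z.coeff d = 0 := by
  have h1 := LaurentSeries.val_le_one_iff_eq_coe K z
  have h2 := LaurentSeries.valuation_le_iff_coeff_lt_eq_zero K (D := 0) (f := z)
  rw [neg_zero, WithZero.exp_zero] at h2
  rw [← h2, h1]
  exact exists_congr fun a => eq_comm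

theorem algebraMap_X_pow (i : ℕ) :
    algebraMap K⟦X⟧ K⸨X⸩ X ^ i = HahnSeries.single (i : ℤ) (1 : K) := by
  rw [← map_pow]
  exact HahnSeries.ofPowerSeries_X_pow i

theorem algebraMap_X_inv_pow (i : ℕ) :
    (algebraMap K⟦X⟧ K⸨X⸩ X)⁻¹ ^ i = HahnSeries.single (-(i : ℤ)) (1 : K) := by
  rw [inv_pow, algebraMap_X_pow, HahnSeries.inv_single, inv_one]

variable {O L : Type u} [Field L] [Algebra K⸨X⸩ L] [Algebra K⟦X⟧ L] [Algebra K L]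
  [IsScalarTower K K⟦X⟧ L] [IsScalarTower K⟦X⟧ K⸨X⸩ L]

/-- The coefficients of degrees `-1, …, -M` of the coordinates of an element of `L`. -/
def polarPart {ι : Type} (b : Module.Basis ι K⸨X⸩ L) (M : ℕ) : L →ₗ[K] (ι × Fin M → K) where
  toFun z s := (b.repr z s.1).coeff (-((s.2 : ℕ) + 1 : ℤ))
  map_add' z w := by ext s; simp
  map_smul' r z := by
    ext s
    have h : r • z = (HahnSeries.C r : K⸨X⸩) • z := by
      rw [← algebraMap_smul K⟦X⟧ r z, ← algebraMap_smul K⸨X⸩ _ z]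
      congr 1
      exact HahnSeries.ofPowerSeries_C r
    rw [h, map_smul, Finsupp.smul_apply]
    simp

theorem polarPart_eq_zero_iff {ι : Type} (b : Module.Basis ι K⸨X⸩ L) (M : ℕ) (z : L)
    (hz : ∀ k, ∃ a : K⟦X⟧, algebraMap K⟦X⟧ K⸨X⸩ X ^ M * b.repr z k = algebraMap K⟦X⟧ K⸨X⸩ a) :
    polarPart b M z = 0 ↔ ∀ k, ∃ a : K⟦X⟧, b.repr z k = algebraMap K⟦X⟧ K⸨X⸩ a := by
  simp_rw [mem_range_algebraMap_iff_coeff] at hz ⊢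
  constructor
  · intro h k d hd
    by_cases hdM : d + M < 0
    · have := hz k _ hdM
      rwa [algebraMap_X_pow, HahnSeries.coeff_single_mul_add, one_mul] at this
    · have := congrFun h (k, ⟨(-d - 1).toNat, by omega⟩)
      simp only [polarPart, LinearMap.coe_mk, AddHom.coe_mk, Pi.zero_apply] at this
      rwa [show (-(((-d - 1).toNat : ℤ) + 1)) = d by omega] at this
  · intro h
    ext s
    exact h s.1 _ (by omega)

theorem polarPart_smul_basis {ι : Type} (b : Module.Basis ι K⸨X⸩ L) (M : ℕ) (s : ι × Fin M) :
    polarPart b M ((algebraMap K⟦X⟧ K⸨X⸩ X)⁻¹ ^ ((s.2 : ℕ) + 1) • b s.1) = Pi.single s 1 := by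
  ext t
  simp only [polarPart, LinearMap.coe_mk, AddHom.coe_mk, map_smul, Finsupp.smul_apply,
    Module.Basis.repr_self, algebraMap_X_inv_pow, smul_eq_mul]
  by_cases h1 : s.1 = t.1
  · rw [h1, Finsupp.single_eq_same, mul_one, HahnSeries.coeff_single, Pi.single_apply]
    have : (-((t.2 : ℕ) + 1 : ℤ) = -(((s.2 : ℕ) + 1 : ℕ) : ℤ)) ↔ t = s := by
      rw [Prod.ext_iff, Fin.ext_iff]
      simp only [h1, true_and]
      omega
    simp only [this]
  · rw [Finsupp.single_eq_of_ne (Ne.symm h1), mul_zero, HahnSeries.coeff_zero, Pi.single_apply,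
      if_neg]
    rintro rfl
    exact h1 rfl

theorem card_le_normalizationCodim [CommRing O] [Algebra O L] [Algebra K O]
    [IsScalarTower K O L] {ι : Type} [Fintype ι] (b : Module.Basis ι K⸨X⸩ L) (M : ℕ)
    (hO : ∀ z : L, z ∈ Set.range (algebraMap O L) ↔
      ∀ k, ∃ a : K⟦X⟧, b.repr z k = algebraMap K⟦X⟧ K⸨X⸩ a)
    (hM : ∀ z : L, IsIntegral O z → ∀ k, ∃ a : K⟦X⟧,
      algebraMap K⟦X⟧ K⸨X⸩ X ^ M * b.repr z k = algebraMap K⟦X⟧ K⸨X⸩ a)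
    (S : Finset (ι × Fin M))
    (hS : ∀ s ∈ S, IsIntegral O ((algebraMap K⟦X⟧ K⸨X⸩ X)⁻¹ ^ ((s.2 : ℕ) + 1) • b s.1)) :
    S.card ≤ normalizationCodim K O L := by
  have hNspan : (Submodule.span K (integralClosure O L : Set L) : Set L) = integralClosure O L :=
    congrArg SetLike.coe (Submodule.span_eq
      (Subalgebra.toSubmodule ((integralClosure O L).restrictScalars K)))
  have hPspan : (Submodule.span K (Set.range (algebraMap O L)) : Set L) =
      Set.range (algebraMap O L) :=
    congrArg SetLike.coe (Submodule.span_eq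
      (LinearMap.range (IsScalarTower.toAlgHom K O L).toLinearMap))
  unfold normalizationCodim
  set N := Submodule.span K (integralClosure O L : Set L)
  set P := Submodule.span K (Set.range (algebraMap O L))
  have hN : ∀ z, z ∈ N ↔ IsIntegral O z := fun z => by
    rw [← SetLike.mem_coe, hNspan]; rfl
  have hker : P.comap N.subtype = LinearMap.ker ((polarPart b M).comp N.subtype) := by
    ext ⟨z, hz⟩
    rw [Submodule.mem_comap, LinearMap.mem_ker, LinearMap.comp_apply, N.subtype_apply,
      polarPart_eq_zero_iff b M z (hM z ((hN z).1 hz)), ← hO, ← hPspan, SetLike.mem_coe]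
  rw [hker, (LinearMap.quotKerEquivRange _).finrank_eq]
  let v : S → LinearMap.range ((polarPart b M).comp N.subtype) := fun s =>
    ⟨Pi.single s.1 1, ⟨_, (hN _).2 (hS s.1 s.2)⟩, polarPart_smul_basis b M s.1⟩
  have hv : LinearIndependent K v := by
    refine LinearIndependent.of_comp (Submodule.subtype _) ?_
    convert! (Pi.basisFun K (ι × Fin M)).linearIndependent.comp
      (Subtype.val : S → _) Subtype.val_injective using 1
    ext s
    simp [v]
  simpa using hv.fintype_card_le_finrank

end Counting

section WeierstrassPolynomial
open PowerSeries LaurentSeries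
variable {K : Type u} [Field K]

theorem card_filter_mul_le (m n M : ℕ) (hm : 0 < m) (hM : n ≤ M) :
    (Finset.univ.filter fun s : Fin m × Fin M => ((s.2 : ℕ) + 1) * m ≤ (s.1 : ℕ) * n).card =
      ∑ j ∈ Finset.range m, j * n / m := by
  rw [← Fin.sum_univ_eq_sum_range (fun j => j * n / m), Finset.card_filter,
    Fintype.sum_prod_type]
  refine Finset.sum_congr rfl fun k _ => ?_
  have hk : (k : ℕ) * n / m ≤ M :=
    (Nat.div_le_of_le_mul (Nat.mul_le_mul_right n k.2.le)).trans hM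
  rw [Fin.sum_univ_eq_sum_range (fun i => if (i + 1) * m ≤ (k : ℕ) * n then 1 else 0),
    ← Finset.card_filter]
  conv_rhs => rw [← Finset.card_range ((k : ℕ) * n / m)]
  congr 1
  ext i
  rw [Finset.mem_filter, Finset.mem_range, Finset.mem_range, ← Nat.le_div_iff_mul_le hm]
  omega

theorem le_two_mul_normalizationCodim {O L : Type u} [Field L] [Algebra K⸨X⸩ L]
    [Algebra K⟦X⟧ L] [Algebra K L] [IsScalarTower K K⟦X⟧ L] [IsScalarTower K⟦X⟧ K⸨X⸩ L]
    [CommRing O] [Algebra O L] [Algebra K O] [IsScalarTower K O L] [Algebra K⟦X⟧ O]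
    [IsScalarTower K⟦X⟧ O L] [Algebra.IsIntegral K⟦X⟧ O] (pb : PowerBasis K⸨X⸩ L)
    (hO : ∀ z : L, z ∈ Set.range (algebraMap O L) ↔
      ∀ k, ∃ a : K⟦X⟧, pb.basis.repr z k = algebraMap K⟦X⟧ K⸨X⸩ a)
    (c : K⟦X⟧) (n : ℕ) (hc : (minpoly K⸨X⸩ pb.gen).coeff 0 = algebraMap K⟦X⟧ K⸨X⸩ c)
    (hn : X ^ n ∣ c) (hn0 : 0 < n) :
    (pb.dim - 1) * (n - 1) + (Nat.gcd pb.dim n - 1) ≤ 2 * normalizationCodim K O L := by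
  have : FiniteDimensional K⸨X⸩ L := pb.finite
  have hint : ∀ z : L, IsIntegral O z ↔ IsIntegral K⟦X⟧ z := fun z =>
    ⟨fun h => isIntegral_trans z h, fun h => h.tower_top⟩
  obtain ⟨N, hN⟩ := exists_pow_mul_repr_mem_range pb.basis
  refine (gcd_le_two_mul_sum_div pb.dim n pb.dim_pos hn0).trans ?_
  rw [← card_filter_mul_le pb.dim n (N + n) pb.dim_pos (Nat.le_add_left n N)]
  refine Nat.mul_le_mul_left 2 (card_le_normalizationCodim pb.basis (N + n) hO ?_ _ ?_)
  · intro z hz k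
    obtain ⟨a, ha⟩ := hN z ((hint z).1 hz) k
    exact ⟨X ^ n * a, by rw [pow_add, mul_right_comm, ha, map_mul, map_pow, mul_comm]⟩
  · intro s hs
    rw [hint, pb.basis_eq_pow, Algebra.smul_def, map_pow]
    refine isIntegral_pow_div pb.gen c n hc hn _ _ ?_
    rw [pb.natDegree_minpoly]
    exact (Finset.mem_filter.1 hs).2

/-- Base change of `K[[X]][Y]/(F)` to `K((X))`. -/
def adjoinRootToLaurent (F : Polynomial K⟦X⟧) :
    AdjoinRoot F →+* AdjoinRoot (F.map (algebraMap K⟦X⟧ K⸨X⸩)) :=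
  AdjoinRoot.map (algebraMap K⟦X⟧ K⸨X⸩) F _ dvd_rfl

theorem adjoinRootToLaurent_mk (F p : Polynomial K⟦X⟧) :
    adjoinRootToLaurent F (AdjoinRoot.mk F p) =
      AdjoinRoot.mk _ (p.map (algebraMap K⟦X⟧ K⸨X⸩)) := by
  induction p using Polynomial.induction_on' with
  | add p q hp hq => simp [hp, hq]
  | monomial i a =>
    simp [adjoinRootToLaurent, ← Polynomial.C_mul_X_pow_eq_monomial]

theorem exists_fractionRing_codim (F : Polynomial K⟦X⟧) (hF : F.Monic) (hirr : Irreducible F)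
    (n : ℕ) (hn : X ^ n ∣ F.coeff 0) (hn0 : 0 < n) :
    ∃ (L : Type u) (_ : Field L) (_ : Algebra K L) (_ : Algebra (AdjoinRoot F) L)
      (_ : IsScalarTower K (AdjoinRoot F) L) (_ : IsFractionRing (AdjoinRoot F) L),
      (F.natDegree - 1) * (n - 1) + (Nat.gcd F.natDegree n - 1) ≤
        2 * normalizationCodim K (AdjoinRoot F) L := by
  set F' := F.map (algebraMap K⟦X⟧ K⸨X⸩) with hF'def
  have hF' : F'.Monic := hF.map _
  have hirr' : Irreducible F' := (hF.irreducible_iff_irreducible_map_fraction_map).1 hirr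
  have : Fact (Irreducible F') := ⟨hirr'⟩
  let L := AdjoinRoot F'
  let alg : Algebra (AdjoinRoot F) L := (adjoinRootToLaurent F).toAlgebra
  have hmk : ∀ p : Polynomial K⟦X⟧, algebraMap (AdjoinRoot F) L (AdjoinRoot.mk F p) =
      AdjoinRoot.mk F' (p.map (algebraMap K⟦X⟧ K⸨X⸩)) := adjoinRootToLaurent_mk F
  have tAOL : IsScalarTower K⟦X⟧ (AdjoinRoot F) L := IsScalarTower.of_algebraMap_eq fun a => by
    have := hmk (Polynomial.C a)
    rw [Polynomial.map_C] at this
    exact this.symm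
  let algK : Algebra K L := ((algebraMap K⟦X⟧ L).comp (algebraMap K K⟦X⟧)).toAlgebra
  have tKAL : IsScalarTower K K⟦X⟧ L := IsScalarTower.of_algebraMap_eq fun _ => rfl
  have tKOL : IsScalarTower K (AdjoinRoot F) L := IsScalarTower.of_algebraMap_eq fun r => by
    rw [IsScalarTower.algebraMap_apply K K⟦X⟧ L,
      IsScalarTower.algebraMap_apply K K⟦X⟧ (AdjoinRoot F),
      IsScalarTower.algebraMap_apply K⟦X⟧ (AdjoinRoot F) L]
  let pb : PowerBasis K⸨X⸩ L := AdjoinRoot.powerBasis' hF'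
  have hdim : pb.dim = F.natDegree := hF.natDegree_map _
  have hfin : Module.Finite K⟦X⟧ (AdjoinRoot F) := hF.finite_adjoinRoot
  have hmin : minpoly K⸨X⸩ pb.gen = F' := by
    refine (minpoly.eq_of_irreducible_of_monic hirr' ?_ hF').symm
    exact AdjoinRoot.eval₂_root F'
  have hrange : ∀ z : L, z ∈ Set.range (algebraMap (AdjoinRoot F) L) ↔
      ∀ k, ∃ a : K⟦X⟧, pb.basis.repr z k = algebraMap K⟦X⟧ K⸨X⸩ a := by
    intro z
    constructor
    · rintro ⟨o, rfl⟩ k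
      obtain ⟨p, rfl⟩ := AdjoinRoot.mk_surjective o
      rw [hmk]
      refine ⟨(p %ₘ F).coeff k, ?_⟩
      rw [← Polynomial.coeff_map, Polynomial.map_modByMonic _ hF]
      exact AdjoinRoot.powerBasisAux'_repr_apply_to_fun hF' _ k
    · intro h
      choose a ha using h
      refine ⟨∑ k, AdjoinRoot.mk F (Polynomial.C (a k) * Polynomial.X ^ (k : ℕ)), ?_⟩
      rw [map_sum, ← pb.basis.sum_repr z]
      refine Finset.sum_congr rfl fun k _ => ?_
      rw [hmk, ha, pb.basis_eq_pow, Algebra.smul_def, Polynomial.map_mul, Polynomial.map_C,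
        Polynomial.map_pow, Polynomial.map_X, map_mul, map_pow]
      rfl
  have hinj : Function.Injective (algebraMap (AdjoinRoot F) L) := by
    rw [injective_iff_map_eq_zero]
    intro o ho
    obtain ⟨p, rfl⟩ := AdjoinRoot.mk_surjective o
    rw [hmk, AdjoinRoot.mk_eq_zero] at ho
    rw [AdjoinRoot.mk_eq_zero]
    exact (Polynomial.map_dvd_map _ (IsFractionRing.injective K⟦X⟧ K⸨X⸩) hF).1 ho
  have hfrac : IsFractionRing (AdjoinRoot F) L := by
    have : FaithfulSMul (AdjoinRoot F) L := (faithfulSMul_iff_algebraMap_injective _ _).2 hinj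
    refine IsFractionRing.of_field _ _ fun z => ?_
    obtain ⟨p, rfl⟩ := AdjoinRoot.mk_surjective z
    obtain ⟨d, hdM, hd⟩ := IsLocalization.integerNormalization_spec (nonZeroDivisors K⟦X⟧) p
    refine ⟨AdjoinRoot.mk F (IsLocalization.integerNormalization (nonZeroDivisors K⟦X⟧) p),
      algebraMap K⟦X⟧ (AdjoinRoot F) d, ?_⟩
    have hd0 : algebraMap K⟦X⟧ L d ≠ 0 := by
      rw [IsScalarTower.algebraMap_apply K⟦X⟧ K⸨X⸩ L, map_ne_zero]
      exact IsFractionRing.to_map_ne_zero_of_mem_nonZeroDivisors hdM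
    rw [hmk, hd, ← IsScalarTower.algebraMap_apply K⟦X⟧ (AdjoinRoot F) L, eq_div_iff hd0,
      mul_comm, Algebra.smul_def, map_mul]
    rfl
  refine ⟨L, inferInstance, algK, alg, tKOL, hfrac, ?_⟩
  rw [← hdim]
  refine le_two_mul_normalizationCodim pb hrange (F.coeff 0) n ?_ hn hn0
  rw [hmin, hF'def, Polynomial.coeff_map]

end WeierstrassPolynomial

section PlaneCurve
open PowerSeries
variable {K : Type u} [Field K]

/-- The isomorphism `K[[x,y]] ≃ K[[y]][[x]]`. -/
def iteratedEquiv : PS K ≃ₐ[K] K⟦X⟧⟦X⟧ :=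
  (MvPowerSeries.renameEquiv K ((finSuccEquiv 1).trans (Equiv.optionCongr finOneEquiv))).trans
    (MvPowerSeries.optionEquivLeft Unit K)

theorem coeff_coeff_iteratedEquiv (f : PS K) (i j : ℕ) :
    coeff j (coeff i (iteratedEquiv f)) = coef K f (i, j) := by
  have := MvPowerSeries.coeff_coeff_optionEquivLeft (MvPowerSeries.renameEquiv K
    ((finSuccEquiv 1).trans (Equiv.optionCongr finOneEquiv)) f) i (Finsupp.single () j)
  refine this.trans ?_
  rw [coef, ← MvPowerSeries.coeff_embDomain_rename
    ((finSuccEquiv 1).trans (Equiv.optionCongr finOneEquiv)).toEmbedding]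
  have h : Finsupp.embDomain
      ((finSuccEquiv 1).trans (Equiv.optionCongr finOneEquiv)).toEmbedding
      (Finsupp.single 0 (i, j).1 + Finsupp.single 1 (i, j).2) =
        Finsupp.optionElim i (Finsupp.single () j) := by
    ext a
    have h1 : finSuccEquiv 1 1 = some 0 := rfl
    cases a <;> simp [Finsupp.embDomain_eq_mapDomain, Finsupp.mapDomain_add, h1]
  rw [h]
  rfl

instance isAdicComplete_maximalIdeal :
    IsAdicComplete (IsLocalRing.maximalIdeal K⟦X⟧) K⟦X⟧ := by
  rw [PowerSeries.maximalIdeal_eq_span_X]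
  infer_instance

theorem residue_coeff_zero_eq_zero {A : Type*} [CommRing A] [IsLocalRing A] {F G : Polynomial A}
    (hF : F.IsDistinguishedAt (IsLocalRing.maximalIdeal A)) (hG : G.Monic) (hdvd : G ∣ F)
    (hdeg : G.natDegree ≠ 0) : IsLocalRing.residue A (G.coeff 0) = 0 := by
  have h : G.map (IsLocalRing.residue A) ∣ Polynomial.X ^ F.natDegree := by
    have hX : F.map (IsLocalRing.residue A) = Polynomial.X ^ F.natDegree := hF.map_eq_X_pow
    exact hX ▸ Polynomial.map_dvd _ hdvd
  obtain ⟨i, -, hi⟩ := (dvd_prime_pow Polynomial.prime_X _).1 h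
  have hi' := Polynomial.eq_of_monic_of_associated (hG.map _) (Polynomial.monic_X_pow i) hi
  have hi0 : i = G.natDegree := by
    rw [← hG.natDegree_map (IsLocalRing.residue A), hi', Polynomial.natDegree_X_pow]
  rw [← Polynomial.coeff_map, hi', Polynomial.coeff_X_pow, if_neg]
  omega

theorem irreducible_of_isWeierstrassFactorization {A : Type*} [CommRing A] [IsDomain A]
    [IsLocalRing A] {g h : A⟦X⟧} {F : Polynomial A} (H : g.IsWeierstrassFactorization F h)
    (hg : Irreducible g) : Irreducible F := by
  have hF : Irreducible (F : A⟦X⟧) := by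
    rwa [H.eq_mul, irreducible_mul_isUnit H.isUnit] at hg
  have key : ∀ G : Polynomial A, G.Monic → G ∣ F → IsUnit (G : A⟦X⟧) → G.natDegree = 0 := by
    intro G hG hdvd hu
    by_contra hdeg
    have h0 := residue_coeff_zero_eq_zero H.isDistinguishedAt hG hdvd hdeg
    rw [PowerSeries.isUnit_iff_constantCoeff] at hu
    rw [IsLocalRing.residue_eq_zero_iff, IsLocalRing.mem_maximalIdeal] at h0
    exact h0 (by simpa using hu)
  rw [H.isDistinguishedAt.monic.irreducible_iff_natDegree]
  refine ⟨fun h1 => hF.not_isUnit (by simp [h1]), fun G G' hG hG' hmul => ?_⟩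
  exact (hF.isUnit_or_isUnit (a := (G : A⟦X⟧)) (b := G') (by rw [← hmul, Polynomial.coe_mul])).imp
    (key G hG ⟨G', hmul.symm⟩) (key G' hG' ⟨G, by rw [← hmul, mul_comm]⟩)

/-- The isomorphism `A[X] / (F) ≃ A⟦X⟧ / (g)` attached to a Weierstrass factorization over a
`k`-algebra `A`, as an isomorphism of `k`-algebras. -/
def weierstrassAlgEquiv (k : Type*) {A : Type*} [CommRing k] [CommRing A] [Algebra k A]
    [IsLocalRing A] [IsAdicComplete (IsLocalRing.maximalIdeal A) A] {g h : A⟦X⟧}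
    {F : Polynomial A} (H : g.IsWeierstrassFactorization F h) :
    (Polynomial A ⧸ Ideal.span {F}) ≃ₐ[k] A⟦X⟧ ⧸ Ideal.span {g} :=
  AlgEquiv.restrictScalars k (S := A) H.algEquivQuotient

theorem numFactors_eq_one {f : PS K} (hf : Irreducible f) : numFactors K f = 1 := by
  have : {P : Associates (PS K) | Irreducible P ∧ P ∣ Associates.mk f} = {Associates.mk f} := by
    ext P
    constructor
    · rintro ⟨hP, hdvd⟩
      exact associated_iff_eq.1 (hP.associated_of_dvd (Associates.irreducible_mk.2 hf) hdvd)
    · rintro rfl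
      exact ⟨Associates.irreducible_mk.2 hf, dvd_rfl⟩
  rw [numFactors, this, Set.ncard_singleton]

theorem delta_eq_normalizationCodim {f : PS K} {O L : Type u} [CommRing O] [CommRing L]
    [Algebra K O] [Algebra K L] [Algebra O L] [IsScalarTower K O L] [IsFractionRing O L]
    (e : CurveRing K f ≃ₐ[K] O) : delta K f = normalizationCodim K O L := by
  have : {d | deltaSpec K f d} = {normalizationCodim K O L} := by
    ext d
    constructor
    · intro hd
      exact (hd (FractionRing (CurveRing K f))).trans (normalizationCodim_congr e)
    · rintro rfl L' _ _ _ _ _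
      exact (normalizationCodim_congr (L := L') (L' := L) e).symm
  rw [delta, this, csInf_singleton]

theorem residue_eq_zero_iff_constantCoeff (a : K⟦X⟧) :
    IsLocalRing.residue K⟦X⟧ a = 0 ↔ coeff 0 a = 0 := by
  rw [IsLocalRing.residue_eq_zero_iff, PowerSeries.maximalIdeal_eq_span_X,
    Ideal.mem_span_singleton, PowerSeries.X_dvd_iff, coeff_zero_eq_constantCoeff_apply]

theorem toNat_order_map_residue_iteratedEquiv {f : PS K} (hf : ∃ a, (a, 0) ∈ supp K f) :
    ((iteratedEquiv f).map (IsLocalRing.residue K⟦X⟧)).order.toNat = ordX K f := by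
  have hiff : ∀ i, coeff i ((iteratedEquiv f).map (IsLocalRing.residue K⟦X⟧)) ≠ 0 ↔
      (i, 0) ∈ supp K f := fun i => by
    rw [PowerSeries.coeff_map, Ne, residue_eq_zero_iff_constantCoeff,
      coeff_coeff_iteratedEquiv]
    rfl
  have hmem : (ordX K f, 0) ∈ supp K f := Nat.sInf_mem hf
  have : ((iteratedEquiv f).map (IsLocalRing.residue K⟦X⟧)).order = ordX K f := by
    rw [PowerSeries.order_eq_nat]
    refine ⟨(hiff _).2 hmem, fun i hi => ?_⟩
    by_contra hne
    exact Nat.notMem_of_lt_sInf hi ((hiff i).1 hne)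
  rw [this, ENat.toNat_natCast]

theorem pos_of_mem_supp {f : PS K} (hf : ¬ IsUnit f) {i j : ℕ} (h : (i, j) ∈ supp K f) :
    0 < i + j := by
  by_contra h0
  obtain ⟨rfl, rfl⟩ : i = 0 ∧ j = 0 := by omega
  refine hf (MvPowerSeries.isUnit_iff_constantCoeff.2 (isUnit_iff_ne_zero.2 ?_))
  simpa [supp, coef] using h

theorem le_two_mul_delta {f : PS K} (hirr : Irreducible f) (hconv : Convenient K f) :
    (ordX K f - 1) * (ordY K f - 1) + (Nat.gcd (ordX K f) (ordY K f) - 1) ≤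
      2 * delta K f := by
  have hX : (ordX K f, 0) ∈ supp K f := Nat.sInf_mem hconv.1
  have hY : (0, ordY K f) ∈ supp K f := Nat.sInf_mem hconv.2
  have hg : (iteratedEquiv f).map (IsLocalRing.residue K⟦X⟧) ≠ 0 := by
    intro h0
    have := congrArg (coeff (ordX K f)) h0
    rw [PowerSeries.coeff_map, map_zero, residue_eq_zero_iff_constantCoeff,
      coeff_coeff_iteratedEquiv] at this
    exact hX this
  obtain ⟨F, h, H⟩ := PowerSeries.exists_isWeierstrassFactorization hg
  have hF : Irreducible F := irreducible_of_isWeierstrassFactorization H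
    ((MulEquiv.irreducible_iff (iteratedEquiv (K := K))).2 hirr)
  have hdeg : F.natDegree = ordX K f :=
    H.natDegree_eq_toNat_order_map.trans (toNat_order_map_residue_iteratedEquiv hconv.1)
  have hdvd : X ^ ordY K f ∣ F.coeff 0 := by
    have h0 : coeff 0 (iteratedEquiv f) = F.coeff 0 * constantCoeff h := by
      rw [H.eq_mul]
      simp
    have hu : IsUnit (constantCoeff h) := PowerSeries.isUnit_iff_constantCoeff.1 H.isUnit
    rw [← hu.dvd_mul_right, ← h0, PowerSeries.X_pow_dvd_iff]
    intro j hj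
    rw [coeff_coeff_iteratedEquiv]
    by_contra hne
    exact Nat.notMem_of_lt_sInf hj hne
  have hY0 : 0 < ordY K f := by simpa using pos_of_mem_supp hirr.not_isUnit hY
  obtain ⟨L, _, _, _, _, _, hL⟩ :=
    exists_fractionRing_codim F H.isDistinguishedAt.monic hF (ordY K f) hdvd hY0
  let e₁ : CurveRing K f ≃ₐ[K] K⟦X⟧⟦X⟧ ⧸ Ideal.span {iteratedEquiv f} :=
    Ideal.quotientEquivAlg _ _ iteratedEquiv (by simp [Ideal.map_span])
  let e₂ : AdjoinRoot F ≃ₐ[K] K⟦X⟧⟦X⟧ ⧸ Ideal.span {iteratedEquiv f} :=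
    weierstrassAlgEquiv K H
  rw [delta_eq_normalizationCodim (L := L) (e₁.trans e₂.symm), ← hdeg]
  exact hL

end PlaneCurve

theorem muBar_irreducible_convenient (K : Type u) [Field K] [IsAlgClosed K]
    (f : PS K) (hirr : Irreducible f) (hconv : Convenient K f)
    (m n d : ℕ) (hm : m = ordX K f) (hn : n = ordY K f) (hd : d = Nat.gcd m n) :
    ((m : ℤ) - 1) * ((n : ℤ) - 1) + (d : ℤ) - 1 ≤ muBar K f := by
  have hX : (ordX K f, 0) ∈ supp K f := Nat.sInf_mem hconv.1
  have hY : (0, ordY K f) ∈ supp K f := Nat.sInf_mem hconv.2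
  have hm0 : 1 ≤ m := by
    have := pos_of_mem_supp hirr.not_isUnit hX
    omega
  have hn0 : 1 ≤ n := by
    have := pos_of_mem_supp hirr.not_isUnit hY
    omega
  have hd0 : 1 ≤ d := hd ▸ Nat.gcd_pos_of_pos_left n hm0
  have key := le_two_mul_delta hirr hconv
  rw [← hm, ← hn, ← hd] at key
  zify [hm0, hn0, hd0] at key
  rw [muBar, numFactors_eq_one hirr]
  push_cast
  linarith

end PlaneCurveNote
end
end
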